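/- arXiv:2106.08583 — 2 statements merged into one kernel-verified Lean document; each statement's English description precedes it below -/
import Mathlib

section
/- Every finitely generated module M over a Noetherian Cohen–Macaulay normal ring R satisfying Ext^i_R(M, M ⊕ R) = 0 for all i > 0 is projective (i.e., the Auslander–Reiten conjecture holds for Cohen–Macaulay normal rings). -/
open CategoryTheory TensorProduct IsLocalRing

noncomputable section

/-- The `n`-th Ext group of two `R`-modules. -/
abbrev extGroup (R : Type) [CommRing R] (n : ℕ) (M N : Type) [AddCommGroup M] [Module R M]
    [AddCommGroup N] [Module R N] : Type :=
  ((Ext R (ModuleCat R) n).obj (Opposite.op (ModuleCat.of R M))).obj (ModuleCat.of R N)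

/-- The `n`-th Tor group of two `R`-modules. -/
abbrev torGroup (R : Type) [CommRing R] (n : ℕ) (M N : Type) [AddCommGroup M] [Module R M]
    [AddCommGroup N] [Module R N] : Type :=
  ((Tor (ModuleCat R) n).obj (ModuleCat.of R M)).obj (ModuleCat.of R N)

/-- The depth of a module over a local ring, as the infimum of the degrees in which
`Ext(k, N)` is nonzero. -/
def moduleDepth (R : Type) [CommRing R] [IsLocalRing R] (N : Type) [AddCommGroup N]
    [Module R N] : ℕ∞ :=
  sInf {n : ℕ∞ | ∃ k : ℕ, n = k ∧
    Nontrivial (extGroup R k (R ⧸ IsLocalRing.maximalIdeal R) N)}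

/-- A module is maximal Cohen–Macaulay if `depth M_p = dim R_p` for all `p` in the support. -/
def IsMCM (R : Type) [CommRing R] (M : Type) [AddCommGroup M] [Module R M] : Prop :=
  ∀ p : PrimeSpectrum R, Nontrivial (LocalizedModule p.asIdeal.primeCompl M) →
    (moduleDepth (Localization.AtPrime p.asIdeal)
        (LocalizedModule p.asIdeal.primeCompl M) : WithBot ℕ∞) =
      ringKrullDim (Localization.AtPrime p.asIdeal)

/-- A local ring is Cohen–Macaulay if its depth equals its Krull dimension. -/
def IsCMLocal (R : Type) [CommRing R] [IsLocalRing R] : Prop :=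
  (moduleDepth R R : WithBot ℕ∞) = ringKrullDim R

/-- Injective dimension at most `n`, defined recursively via cosyzygies. -/
def hasInjDimLE (R : Type) [CommRing R] : ℕ → ∀ (M : Type) [AddCommGroup M] [Module R M], Prop
  | 0, M, _, _ => Module.Injective R M
  | (n+1), M, _, _ => ∃ (I : Type) (_ : AddCommGroup I) (_ : Module R I) (f : M →ₗ[R] I),
      Module.Injective R I ∧ Function.Injective f ∧
        hasInjDimLE R n (I ⧸ LinearMap.range f)

/-- Projective dimension at most `n`, defined recursively via syzygies. -/
def hasPdLE (R : Type) [CommRing R] : ℕ → ∀ (M : Type) [AddCommGroup M] [Module R M], Prop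
  | 0, M, _, _ => Module.Projective R M
  | (n+1), M, _, _ => ∃ (P : Type) (_ : AddCommGroup P) (_ : Module R P) (f : P →ₗ[R] M),
      Module.Projective R P ∧ Function.Surjective f ∧ hasPdLE R n (LinearMap.ker f)

/-- `ω` is a canonical module of the Cohen–Macaulay local ring `R`: it is finitely generated,
maximal Cohen–Macaulay, of finite injective dimension, and of type one. -/
def IsCanonicalModule (R : Type) [CommRing R] [IsLocalRing R] (ω : Type) [AddCommGroup ω]
    [Module R ω] : Prop :=
  Module.Finite R ω ∧ IsMCM R ω ∧ (∃ n, hasInjDimLE R n ω) ∧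
    ∃ d : ℕ, ringKrullDim R = d ∧
      Nonempty (extGroup R d (R ⧸ IsLocalRing.maximalIdeal R) ω ≃ₗ[R]
        (R ⧸ IsLocalRing.maximalIdeal R))

/-- `T` is an Auslander transpose of `M`: the cokernel of the `R`-dual of a minimal
free presentation of `M`. -/
def IsAuslanderTranspose (R : Type) [CommRing R] [IsLocalRing R] (M T : Type)
    [AddCommGroup M] [Module R M] [AddCommGroup T] [Module R T] : Prop :=
  ∃ (m n : ℕ) (f : (Fin n → R) →ₗ[R] (Fin m → R)),
    LinearMap.range f ≤ (IsLocalRing.maximalIdeal R) • (⊤ : Submodule R (Fin m → R)) ∧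
    LinearMap.ker f ≤ (IsLocalRing.maximalIdeal R) • (⊤ : Submodule R (Fin n → R)) ∧
    Nonempty (((Fin m → R) ⧸ LinearMap.range f) ≃ₗ[R] M) ∧
    Nonempty ((Module.Dual R (Fin n → R) ⧸ LinearMap.range f.dualMap) ≃ₗ[R] T)

end

theorem subsingleton_abelianExt_of_subsingleton_Ext {R : Type} [CommRing R] (n : ℕ)
    (X Y : ModuleCat.{0} R)
    (h : Subsingleton (((Ext R (ModuleCat R) n).obj (Opposite.op X)).obj Y)) :
    Subsingleton (Abelian.Ext X Y n) := by
  let P : ProjectiveResolution X := ProjectiveResolution.of X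
  have hz : Limits.IsZero ((P.complex.linearYonedaObj R Y).homology n) :=
    (ModuleCat.isZero_of_subsingleton _).of_iso (P.isoExt (R := R) n Y).symm
  rw [← HomologicalComplex.exactAt_iff_isZero_homology] at hz
  refine subsingleton_of_forall_eq 0 fun α => ?_
  obtain ⟨f, hf, rfl⟩ := P.extMk_surjective α (n + 1) rfl
  cases n with
  | zero =>
    rw [HomologicalComplex.exactAt_iff' _ 0 0 1 (by simp) (by simp)] at hz
    rw [ShortComplex.moduleCat_exact_iff] at hz
    obtain ⟨g, hg⟩ := hz f hf
    have : f = 0 := by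
      rw [← hg]
      have h0 : (P.complex.linearYonedaObj R Y).d 0 0 = 0 :=
        HomologicalComplex.shape _ _ _ (by simp)
      simp only [HomologicalComplex.shortComplexFunctor'_obj_f, h0]
      rfl
    subst this
    simp
  | succ m =>
    rw [HomologicalComplex.exactAt_iff' _ m (m + 1) (m + 2) (by simp) (by simp)] at hz
    rw [ShortComplex.moduleCat_exact_iff] at hz
    obtain ⟨g, hg⟩ := hz f hf
    rw [P.extMk_eq_zero_iff _ _ _ _ m rfl]
    exact ⟨g, hg⟩

theorem subsingleton_abelianExt_of_shortExact {R : Type} [CommRing R]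
    {S : ShortComplex (ModuleCat.{0} R)} (hS : S.ShortExact) [Projective S.X₂]
    (Y : ModuleCat.{0} R) (n : ℕ) (hn : 0 < n)
    (h : Subsingleton (Abelian.Ext S.X₃ Y (1 + n))) : Subsingleton (Abelian.Ext S.X₁ Y n) := by
  refine subsingleton_of_forall_eq 0 fun α => ?_
  obtain ⟨β, rfl⟩ := Abelian.Ext.contravariant_sequence_exact₁ hS Y α rfl (Subsingleton.elim _ _)
  obtain ⟨m, rfl⟩ := Nat.exists_eq_succ_of_ne_zero hn.ne'
  rw [Abelian.Ext.eq_zero_of_projective β, Abelian.Ext.comp_zero]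

theorem exists_extension_of_subsingleton_abelianExt {R : Type} [CommRing R]
    {S : ShortComplex (ModuleCat.{0} R)}
    (hS : S.ShortExact) (Y : ModuleCat.{0} R)
    (h : Subsingleton (Abelian.Ext S.X₃ Y 1)) (f : S.X₁ ⟶ Y) : ∃ g : S.X₂ ⟶ Y, S.f ≫ g = f := by
  obtain ⟨β, hβ⟩ := Abelian.Ext.contravariant_sequence_exact₁ hS Y (Abelian.Ext.mk₀ f)
    (add_zero 1) (Subsingleton.elim _ _)
  obtain ⟨g, rfl⟩ := (Abelian.Ext.mk₀_bijective _ _).surjective β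
  rw [Abelian.Ext.mk₀_comp_mk₀] at hβ
  exact ⟨g, (Abelian.Ext.mk₀_bijective _ _).injective hβ⟩

theorem LinearMap.exists_comp_eq_of_ker_le {R : Type*} [CommRing R] {M N P : Type*} [AddCommGroup M]
    [AddCommGroup N] [AddCommGroup P] [Module R M] [Module R N] [Module R P]
    (p : M →ₗ[R] P) (hp : Function.Surjective p) (f : M →ₗ[R] N) (h : ker p ≤ ker f) :
    ∃ g : P →ₗ[R] N, g ∘ₗ p = f := by
  refine ⟨(ker p).liftQ f h ∘ₗ (p.quotKerEquivOfSurjective hp).symm.toLinearMap, ?_⟩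
  ext x
  have : (p.quotKerEquivOfSurjective hp).symm (p x) = (ker p).mkQ x := by
    rw [LinearEquiv.symm_apply_eq]; rfl
  simp [this]

theorem LinearMap.exists_comp_eq_of_exact {R : Type*} [CommRing R]
    {K M N P : Type*} [AddCommGroup K] [AddCommGroup M] [AddCommGroup N] [AddCommGroup P]
    [Module R K] [Module R M] [Module R N] [Module R P]
    {i : K →ₗ[R] M} {p : M →ₗ[R] P} (hip : Function.Exact i p)
    (hp : Function.Surjective p) (f : M →ₗ[R] N) (h : f ∘ₗ i = 0) :
    ∃ g : P →ₗ[R] N, g ∘ₗ p = f := by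
  refine p.exists_comp_eq_of_ker_le hp f ?_
  rw [hip.linearMap_ker_eq, LinearMap.range_le_ker_iff]
  exact h

theorem LinearMap.exists_comp_eq_of_exact_injective {R : Type*} [CommRing R]
    {K M N P : Type*} [AddCommGroup K] [AddCommGroup M] [AddCommGroup N] [AddCommGroup P]
    [Module R K] [Module R M] [Module R N] [Module R P]
    {i : K →ₗ[R] M} {p : M →ₗ[R] P} (hi : Function.Injective i) (hip : Function.Exact i p)
    (f : N →ₗ[R] M) (h : p ∘ₗ f = 0) :
    ∃ g : N →ₗ[R] K, i ∘ₗ g = f := by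
  have hf : ∀ x, f x ∈ range i := fun x => (hip _).mp (LinearMap.congr_fun h x)
  refine ⟨(LinearEquiv.ofInjective i hi).symm.toLinearMap ∘ₗ f.codRestrict _ hf, ?_⟩
  ext x
  have := (LinearEquiv.ofInjective i hi).apply_symm_apply ⟨f x, hf x⟩
  exact congrArg Subtype.val this

/-- A resolution of a module by finitely generated free modules. -/
structure FreeResolution (R M : Type) [CommRing R] [AddCommGroup M] [Module R M] where
  F : ℕ → Type
  [addCommGroup : ∀ j, AddCommGroup (F j)]
  [module : ∀ j, Module R (F j)]
  [finite : ∀ j, Module.Finite R (F j)]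
  [free : ∀ j, Module.Free R (F j)]
  d : ∀ j, F (j + 1) →ₗ[R] F j
  ε : F 0 →ₗ[R] M
  ε_surjective : Function.Surjective ε
  exact_ε : Function.Exact (d 0) ε
  exact_d : ∀ j, Function.Exact (d (j + 1)) (d j)

namespace FreeResolution

attribute [instance] addCommGroup module finite free

variable {R M : Type} [CommRing R] [AddCommGroup M] [Module R M] (P : FreeResolution R M)

theorem d_comp_d (j : ℕ) : P.d j ∘ₗ P.d (j + 1) = 0 := (P.exact_d j).linearMap_comp_eq_zero

theorem ε_comp_d : P.ε ∘ₗ P.d 0 = 0 := P.exact_ε.linearMap_comp_eq_zero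

/-- The resolution of the first syzygy obtained by truncation. -/
def syzygy : FreeResolution R (LinearMap.ker P.ε) where
  F j := P.F (j + 1)
  d j := P.d (j + 1)
  ε := (P.d 0).codRestrict _ fun x => P.exact_ε.apply_apply_eq_zero x
  ε_surjective := by
    rintro ⟨x, hx⟩
    obtain ⟨y, rfl⟩ := (P.exact_ε x).mp hx
    exact ⟨y, rfl⟩
  exact_ε x := by
    rw [← P.exact_d 0 x, Subtype.ext_iff]
    rfl
  exact_d j := P.exact_d (j + 1)

/-- The complex `Hom(P, N)` is exact in positive degrees. -/
def Acyclic (N : Type*) [AddCommGroup N] [Module R N] : Prop :=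
  ∀ (j : ℕ) (f : P.F (j + 1) →ₗ[R] N), f ∘ₗ P.d (j + 1) = 0 →
    ∃ g : P.F j →ₗ[R] N, g ∘ₗ P.d j = f

variable {P}

theorem Acyclic.syzygy {N : Type*} [AddCommGroup N] [Module R N] (h : P.Acyclic N) :
    P.syzygy.Acyclic N := fun j f hf => h (j + 1) f hf

theorem Acyclic.of_retract {N N' : Type*} [AddCommGroup N] [Module R N] [AddCommGroup N']
    [Module R N'] (h : P.Acyclic N) (i : N' →ₗ[R] N) (q : N →ₗ[R] N') (hqi : q ∘ₗ i = .id) :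
    P.Acyclic N' := by
  intro j f hf
  obtain ⟨g, hg⟩ := h j (i ∘ₗ f) (by rw [LinearMap.comp_assoc, hf, LinearMap.comp_zero])
  refine ⟨q ∘ₗ g, ?_⟩
  rw [LinearMap.comp_assoc, hg, ← LinearMap.comp_assoc, hqi, LinearMap.id_comp]

theorem Acyclic.pi {n : Type*} (h : P.Acyclic R) : P.Acyclic (n → R) := by
  intro j f hf
  have (k : n) : ∃ g : P.F j →ₗ[R] R, g ∘ₗ P.d j = LinearMap.proj k ∘ₗ f :=
    h j _ (by rw [LinearMap.comp_assoc, hf, LinearMap.comp_zero])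
  choose g hg using this
  exact ⟨LinearMap.pi g, LinearMap.ext fun x => funext fun k => LinearMap.congr_fun (hg k) x⟩

theorem Acyclic.of_projective (h : P.Acyclic R) (N : Type*) [AddCommGroup N] [Module R N]
    [Module.Finite R N] [Module.Projective R N] : P.Acyclic N := by
  obtain ⟨n, q, hq⟩ := Module.Finite.exists_fin' R N
  obtain ⟨i, hi⟩ := Module.projective_lifting_property q .id hq
  exact (h.pi (n := Fin n)).of_retract i q hi

section Exact

variable {N' N N'' : Type*} [AddCommGroup N'] [Module R N'] [AddCommGroup N] [Module R N]
  [AddCommGroup N''] [Module R N''] {i : N' →ₗ[R] N} {q : N →ₗ[R] N''}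

theorem Acyclic.of_exact (hi : Function.Injective i) (hiq : Function.Exact i q)
    (hq : Function.Surjective q) (h' : P.Acyclic N') (h : P.Acyclic N) : P.Acyclic N'' := by
  intro j f hf
  obtain ⟨f', rfl⟩ := Module.projective_lifting_property q f hq
  obtain ⟨g', hg'⟩ := LinearMap.exists_comp_eq_of_exact_injective hi hiq (f' ∘ₗ P.d (j + 1)) hf
  obtain ⟨g, rfl⟩ := h' (j + 1) g' (by
    rw [← LinearMap.cancel_left hi, ← LinearMap.comp_assoc, hg', LinearMap.comp_assoc, d_comp_d]
    simp)
  obtain ⟨k, hk⟩ := h j (f' - i ∘ₗ g) (by rw [LinearMap.sub_comp, ← hg']; ext; simp)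
  refine ⟨q ∘ₗ k, ?_⟩
  rw [LinearMap.comp_assoc, hk, LinearMap.comp_sub, ← LinearMap.comp_assoc (f := g),
    hiq.linearMap_comp_eq_zero, LinearMap.zero_comp, sub_zero]

theorem Acyclic.exists_lift (hi : Function.Injective i) (hiq : Function.Exact i q)
    (hq : Function.Surjective q) (h' : P.Acyclic N') (f : M →ₗ[R] N'') :
    ∃ g : M →ₗ[R] N, q ∘ₗ g = f := by
  obtain ⟨f', hf'⟩ := Module.projective_lifting_property q (f ∘ₗ P.ε) hq
  obtain ⟨g', hg'⟩ := LinearMap.exists_comp_eq_of_exact_injective hi hiq (f' ∘ₗ P.d 0) (by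
    rw [← LinearMap.comp_assoc, hf', LinearMap.comp_assoc, ε_comp_d, LinearMap.comp_zero])
  obtain ⟨g, rfl⟩ := h' 0 g' (by
    rw [← LinearMap.cancel_left hi, ← LinearMap.comp_assoc, hg', LinearMap.comp_assoc, d_comp_d]
    simp)
  obtain ⟨k, hk⟩ := LinearMap.exists_comp_eq_of_exact P.exact_ε P.ε_surjective (f' - i ∘ₗ g)
    (by rw [LinearMap.sub_comp, ← hg']; ext; simp)
  refine ⟨k, ?_⟩
  rw [← LinearMap.cancel_right P.ε_surjective, LinearMap.comp_assoc, hk, LinearMap.comp_sub,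
    ← LinearMap.comp_assoc (f := g), hiq.linearMap_comp_eq_zero, hf', LinearMap.zero_comp,
    sub_zero]

end Exact

theorem Acyclic.syzygy_ker (hR : P.Acyclic R) (hM : P.Acyclic M) :
    P.syzygy.Acyclic (LinearMap.ker P.ε) := by
  intro j (f : P.F (j + 1 + 1) →ₗ[R] _) (hf : f ∘ₗ P.d (j + 1 + 1) = 0)
  obtain ⟨g, hg⟩ := (hR.of_projective (P.F 0)) (j + 1) ((LinearMap.ker P.ε).subtype ∘ₗ f)
    (by rw [LinearMap.comp_assoc, hf, LinearMap.comp_zero])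
  have hg (x) : g (P.d (j + 1) x) = f x := LinearMap.congr_fun hg x
  obtain ⟨h, hh⟩ := hM j (P.ε ∘ₗ g) (by ext x; simp [hg])
  obtain ⟨h', rfl⟩ := Module.projective_lifting_property P.ε h P.ε_surjective
  refine ⟨(g - h' ∘ₗ P.d j).codRestrict _ fun x => ?_, ?_⟩
  · have : P.ε (h' (P.d j x)) = P.ε (g x) := LinearMap.congr_fun hh x
    simp [this]
  · refine LinearMap.ext fun x : P.F (j + 1 + 1) => Subtype.ext ?_
    have h2 : P.d j (P.d (j + 1) x) = 0 := LinearMap.congr_fun (P.d_comp_d j) x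
    change g (P.d (j + 1) x) - h' (P.d j (P.d (j + 1) x)) = f x
    rw [hg, h2, map_zero, sub_zero]

theorem Acyclic.projective (hR : P.Acyclic R) [IsNoetherianRing R]
    [Module.Projective R (LinearMap.ker P.ε)] : Module.Projective R M := by
  obtain ⟨g, hg⟩ := (hR.of_projective (LinearMap.ker P.ε)) 0 P.syzygy.ε P.syzygy.ε_comp_d
  obtain ⟨s, hs⟩ := LinearMap.exists_comp_eq_of_exact P.exact_ε P.ε_surjective
    (.id - (LinearMap.ker P.ε).subtype ∘ₗ g) (by
      rw [LinearMap.sub_comp, LinearMap.comp_assoc, hg]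
      ext x
      exact sub_self (P.d 0 x))
  refine Module.Projective.of_split s P.ε ?_
  rw [← LinearMap.cancel_right P.ε_surjective, LinearMap.comp_assoc, hs]
  ext x
  simp

section Localization

variable (S : Submonoid R)

variable (P) in
/-- The localization of a free resolution. -/
noncomputable def localization : FreeResolution (Localization S) (LocalizedModule S M) where
  F j := LocalizedModule S (P.F j)
  finite j := Module.Finite.of_isLocalizedModule S (LocalizedModule.mkLinearMap S (P.F j))
  free j := Module.free_of_isLocalizedModule S (LocalizedModule.mkLinearMap S (P.F j))
  d j := LocalizedModule.map S (P.d j)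
  ε := LocalizedModule.map S P.ε
  ε_surjective := LocalizedModule.map_surjective S _ P.ε_surjective
  exact_ε := LocalizedModule.map_exact S _ _ P.exact_ε
  exact_d j := LocalizedModule.map_exact S _ _ (P.exact_d j)

theorem Acyclic.localization [IsNoetherianRing R] {N : Type} [AddCommGroup N] [Module R N]
    (h : P.Acyclic N) :
    (P.localization S).Acyclic (LocalizedModule S N) := by
  intro j (f : LocalizedModule S (P.F (j + 1)) →ₗ[Localization S] LocalizedModule S N)
    (hf : f ∘ₗ LocalizedModule.map S (P.d (j + 1)) = 0)
  have := Module.finitePresentation_of_finite R (P.F (j + 1))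
  obtain ⟨f', s, hs⟩ := Module.FinitePresentation.exists_lift_of_isLocalizedModule S
    (LocalizedModule.mkLinearMap S N)
    (f.restrictScalars R ∘ₗ LocalizedModule.mkLinearMap S (P.F (j + 1)))
  have hs (x) : LocalizedModule.mk (f' x) (1 : S) = s • f (LocalizedModule.mk x 1) :=
    LinearMap.congr_fun hs x
  obtain ⟨t, ht⟩ := Module.Finite.exists_smul_of_comp_eq_of_isLocalizedModule S
    (LocalizedModule.mkLinearMap S N) (f' ∘ₗ P.d (j + 1)) 0 (by
      ext x
      have : f (LocalizedModule.mk (P.d (j + 1) x) 1) = 0 := by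
        simpa using LinearMap.congr_fun hf (LocalizedModule.mk x 1)
      simp [hs, this])
  obtain ⟨g, hg⟩ := h j (t • f') (by rw [LinearMap.smul_comp, ht, smul_zero])
  have hg (x) : g (P.d j x) = t • f' x := LinearMap.congr_fun hg x
  suffices ∃ g : LocalizedModule S (P.F j) →ₗ[Localization S] LocalizedModule S N,
      g ∘ₗ LocalizedModule.map S (P.d j) = f from this
  refine ⟨Localization.mk 1 (t * s) • LocalizedModule.map S g, ?_⟩
  rw [← LinearMap.restrictScalars_inj R]
  refine IsLocalizedModule.linearMap_ext S (LocalizedModule.mkLinearMap S _)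
    (LocalizedModule.mkLinearMap S _) ?_
  ext x
  have h2 : LocalizedModule.mk (t • f' x) 1 = ((t * s : S) : R) • f (LocalizedModule.mk x 1) := by
    rw [Submonoid.coe_mul, mul_smul, ← Submonoid.smul_def s, ← hs, LocalizedModule.smul'_mk]
    rfl
  change Localization.mk 1 (t * s) •
      LocalizedModule.map S g (LocalizedModule.map S (P.d j) (LocalizedModule.mk x 1)) =
        f (LocalizedModule.mk x 1)
  rw [LocalizedModule.map_mk, LocalizedModule.map_mk, hg, h2,
    ← algebraMap_smul (Localization S) ((t * s : S) : R), smul_smul,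
    ← Localization.mk_one_eq_algebraMap, Localization.mk_mul, one_mul, mul_one,
    Localization.mk_self, one_smul]

end Localization

section Existence

variable {R : Type} [CommRing R]

/-- A surjection from a standard free module onto a finitely generated module. -/
noncomputable def cover (N : Type) [AddCommGroup N] [Module R N] [Module.Finite R N] :
    (Fin (Module.Finite.exists_fin' R N).choose → R) →ₗ[R] N :=
  (Module.Finite.exists_fin' R N).choose_spec.choose

theorem cover_surjective (N : Type) [AddCommGroup N] [Module R N] [Module.Finite R N] :
    Function.Surjective (cover (R := R) N) :=
  (Module.Finite.exists_fin' R N).choose_spec.choose_spec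

theorem exact_subtype_comp {F G N : Type} [AddCommGroup F] [Module R F] [AddCommGroup G]
    [Module R G] [AddCommGroup N] [Module R N] {K : Submodule R G} (q : F →ₗ[R] K)
    (hq : Function.Surjective q) (p : G →ₗ[R] N) (hp : LinearMap.ker p = K) :
    Function.Exact (K.subtype ∘ₗ q) p := by
  rw [LinearMap.exact_iff, LinearMap.range_comp_of_range_eq_top _ (LinearMap.range_eq_top.mpr hq),
    Submodule.range_subtype, hp]

variable (M : Type) [AddCommGroup M] [Module R M] [IsNoetherianRing R] [Module.Finite R M]

/-- The iterated syzygies of a finitely generated module, as submodules of free modules. -/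
noncomputable def syzygies : ℕ → Σ n : ℕ, Submodule R (Fin n → R)
  | 0 => ⟨_, LinearMap.ker (cover M)⟩
  | j + 1 => ⟨_, LinearMap.ker (cover (syzygies j).2)⟩

theorem nonempty : Nonempty (FreeResolution R M) := by
  refine ⟨{ F := fun j => Fin (syzygies (R := R) M j).1 → R
            d := fun j => (syzygies M j).2.subtype ∘ₗ cover (syzygies M j).2
            ε := cover M
            ε_surjective := cover_surjective M
            exact_ε := ?_
            exact_d := ?_ }⟩
  · exact exact_subtype_comp _ (cover_surjective _) _ rfl
  · exact fun j => exact_subtype_comp _ (cover_surjective _) _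
      (LinearMap.ker_comp_of_ker_eq_bot _ (Submodule.ker_subtype _))

end Existence

theorem acyclic_of_subsingleton_ext {R M : Type} [CommRing R] [AddCommGroup M] [Module R M]
    (P : FreeResolution R M) (N : Type) [AddCommGroup N] [Module R N]
    (h : ∀ i, 0 < i → Subsingleton (Abelian.Ext (ModuleCat.of R M) (ModuleCat.of R N) i)) :
    P.Acyclic N := by
  intro j
  have hS {M : Type} [AddCommGroup M] [Module R M] (P : FreeResolution R M) :=
    LinearMap.shortExact_shortComplexKer P.ε_surjective
  induction j generalizing M with
  | zero =>
    intro f hf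
    obtain ⟨g, hg⟩ := LinearMap.exists_comp_eq_of_exact P.syzygy.exact_ε P.syzygy.ε_surjective f hf
    obtain ⟨k, hk⟩ := exists_extension_of_subsingleton_abelianExt (hS P) (ModuleCat.of R N)
      (h 1 one_pos) (ModuleCat.ofHom g)
    refine ⟨k.hom, ?_⟩
    rw [← hg]
    ext x
    exact LinearMap.congr_fun (congrArg ModuleCat.Hom.hom hk) (P.syzygy.ε x)
  | succ j ih =>
    refine ih P.syzygy fun i hi => ?_
    have : Projective (P.ε.shortComplexKer).X₂ :=
      ModuleCat.projective_of_categoryTheory_projective (ModuleCat.of R (P.F 0))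
    exact subsingleton_abelianExt_of_shortExact (hS P) (ModuleCat.of R N) i hi (h _ (by omega))

end FreeResolution

open RingTheory.Sequence in
theorem RingTheory.Sequence.IsWeaklyRegular.concat_of_exact {R : Type*} [CommRing R]
    {K F M : Type*} [AddCommGroup K] [AddCommGroup F] [AddCommGroup M] [Module R K] [Module R F]
    [Module R M] {i : K →ₗ[R] F} {p : F →ₗ[R] M} (hi : Function.Injective i)
    (hip : Function.Exact i p) (hp : Function.Surjective p) {rs : List R} {x : R}
    (hM : IsWeaklyRegular M rs) (hF : IsWeaklyRegular F (rs ++ [x])) :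
    IsWeaklyRegular K (rs ++ [x]) := by
  induction rs generalizing K F M with
  | nil =>
    rw [List.nil_append, isWeaklyRegular_singleton_iff] at hF ⊢
    exact hF.of_injective i hi
  | cons r rs ih =>
    rw [List.cons_append, isWeaklyRegular_cons_iff] at hF ⊢
    rw [isWeaklyRegular_cons_iff] at hM
    refine ⟨hF.1.of_injective i hi, ih (i := QuotSMulTop.map r i) (p := QuotSMulTop.map r p) ?_
      (QuotSMulTop.map_exact r hip hp) (QuotSMulTop.map_surjective r hp) hM.2 hF.2⟩
    have h0 : Function.Exact (0 : K →ₗ[R] K) i := by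
      rwa [LinearMap.exact_zero_iff_injective]
    have := QuotSMulTop.map_first_exact_on_four_term_exact_of_isSMulRegular_last h0 hip hM.1
    rw [map_zero] at this
    rwa [LinearMap.exact_zero_iff_injective] at this

open RingTheory.Sequence in
theorem RingTheory.Sequence.IsWeaklyRegular.mem_smul_top_of_exact {R : Type*} [CommRing R]
    {K F M : Type*} [AddCommGroup K] [AddCommGroup F] [AddCommGroup M] [Module R K] [Module R F]
    [Module R M] {i : K →ₗ[R] F} {p : F →ₗ[R] M} (hi : Function.Injective i)
    (hip : Function.Exact i p) (hp : Function.Surjective p) {rs : List R}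
    (hM : IsWeaklyRegular M rs) {x : K} (hx : i x ∈ Ideal.ofList rs • (⊤ : Submodule R F)) :
    x ∈ Ideal.ofList rs • (⊤ : Submodule R K) := by
  have h0 : Function.Exact (0 : K →ₗ[R] K) i := by
    rwa [LinearMap.exact_zero_iff_injective]
  have := map_first_exact_on_four_term_right_exact_of_isSMulRegular_last h0 hip hp hM
  obtain ⟨y, hy⟩ := (this (Submodule.Quotient.mk x)).mp (by simpa using hx)
  induction y using Submodule.Quotient.induction_on with
  | H y => simpa [← Submodule.Quotient.mk_eq_zero, eq_comm] using hy

namespace FreeResolution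

open RingTheory.Sequence
open scoped Pointwise

variable {R M : Type} [CommRing R] [AddCommGroup M] [Module R M] {P : FreeResolution R M}

theorem exact_lsmul_mkQ (N : Type*) [AddCommGroup N] [Module R N] (r : R) :
    Function.Exact (LinearMap.lsmul R N r) (Submodule.mkQ (r • (⊤ : Submodule R N))) := by
  rw [LinearMap.exact_iff, Submodule.ker_mkQ, Submodule.pointwise_smul_def, Submodule.map_top]
  rfl

theorem Acyclic.quotSMulTop {N : Type*} [AddCommGroup N] [Module R N] (hN : P.Acyclic N) {r : R}
    (hr : IsSMulRegular N r) : P.Acyclic (QuotSMulTop r N) :=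
  Acyclic.of_exact (i := LinearMap.lsmul R N r) hr (exact_lsmul_mkQ N r)
    (Submodule.mkQ_surjective _) hN hN

theorem Acyclic.exists_lift_of_isWeaklyRegular {N N' : Type*} [AddCommGroup N] [Module R N]
    [AddCommGroup N'] [Module R N'] (hN : P.Acyclic N) {rs : List R} (hrs : IsWeaklyRegular N rs)
    (q : N →ₗ[R] N') (hq : Function.Surjective q)
    (hker : LinearMap.ker q = Ideal.ofList rs • (⊤ : Submodule R N)) (f : M →ₗ[R] N') :
    ∃ g : M →ₗ[R] N, q ∘ₗ g = f := by
  induction rs generalizing N with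
  | nil =>
    let e := LinearEquiv.ofBijective q ⟨LinearMap.ker_eq_bot.mp (by simpa using hker), hq⟩
    exact ⟨e.symm.toLinearMap ∘ₗ f, by ext x; exact e.apply_symm_apply _⟩
  | cons r rs ih =>
    rw [isWeaklyRegular_cons_iff] at hrs
    rw [Ideal.ofList_cons_smul] at hker
    have hle : r • (⊤ : Submodule R N) ≤ LinearMap.ker q := hker ▸ le_sup_left
    obtain ⟨f', rfl⟩ := ih (hN.quotSMulTop hrs.1) hrs.2 (Submodule.liftQ _ q hle) (by
      rw [← LinearMap.range_eq_top, Submodule.range_liftQ, LinearMap.range_eq_top]; exact hq) (by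
      rw [Submodule.ker_liftQ, hker, Submodule.map_sup, Submodule.mkQ_map_self, bot_sup_eq,
        Submodule.map_smul'', Submodule.map_top, Submodule.range_mkQ])
    obtain ⟨g, rfl⟩ := Acyclic.exists_lift (i := LinearMap.lsmul R N r) hrs.1 (exact_lsmul_mkQ N r)
      (Submodule.mkQ_surjective _) hN f'
    exact ⟨g, by rw [← LinearMap.comp_assoc, Submodule.liftQ_mkQ]⟩

theorem Acyclic.mem_ofList_smul_top {N : Type*} [AddCommGroup N] [Module R N]
    (hN : P.Acyclic N) {rs : List R} (hrs : IsWeaklyRegular N rs) (f : M →ₗ[R] N)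
    (hf : ∀ x, f x ∈ Ideal.ofList rs • (⊤ : Submodule R N)) :
    f ∈ Ideal.ofList rs • (⊤ : Submodule R (M →ₗ[R] N)) := by
  induction rs generalizing N with
  | nil =>
    have : f = 0 := by ext x; simpa using hf x
    simp [this]
  | cons r rs ih =>
    rw [isWeaklyRegular_cons_iff] at hrs
    let q := Submodule.mkQ (r • (⊤ : Submodule R N))
    have hq : Function.Surjective (LinearMap.compRight R q : (M →ₗ[R] N) →ₗ[R] _) :=
      Acyclic.exists_lift (i := LinearMap.lsmul R N r) hrs.1 (exact_lsmul_mkQ N r)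
        (Submodule.mkQ_surjective _) hN
    have h1 := ih (hN.quotSMulTop hrs.1) hrs.2 (q ∘ₗ f) (fun x => by
      have := Submodule.mem_map_of_mem (f := q) (hf x)
      rwa [Ideal.ofList_cons_smul, Submodule.map_sup, Submodule.mkQ_map_self, bot_sup_eq,
        Submodule.map_smul'', Submodule.map_top, Submodule.range_mkQ] at this)
    rw [← LinearMap.range_eq_top.mpr hq, ← Submodule.map_top, ← Submodule.map_smul''] at h1
    obtain ⟨g, hg, hgf⟩ := h1
    obtain ⟨h, hh⟩ := LinearMap.exists_comp_eq_of_exact_injective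
      (i := LinearMap.lsmul R N r) hrs.1 (exact_lsmul_mkQ N r)
      (f - g) (by rw [LinearMap.comp_sub, sub_eq_zero]; exact hgf.symm)
    rw [Ideal.ofList_cons_smul]
    rw [← sub_add_cancel f g, ← hh]
    exact Submodule.add_mem_sup (Submodule.smul_mem_pointwise_smul h r ⊤ trivial) hg

end FreeResolution

theorem LinearMap.isIntegral_trace {A K V : Type*} [CommRing A] [Field K] [Algebra A K]
    [AddCommGroup V] [Module K V] [Module.Finite K V] [Module A V] [IsScalarTower A K V]
    (φ : Module.End K V) (hφ : IsIntegral A φ) : IsIntegral A (LinearMap.trace K V φ) := by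
  let L := AlgebraicClosure K
  let ψ : Module.End L (L ⊗[K] V) := Module.End.baseChangeHom K L V φ
  have hψ : IsIntegral A ψ := hφ.map ((Module.End.baseChangeHom K L V).restrictScalars A)
  have htr : LinearMap.trace L (L ⊗[K] V) ψ = algebraMap K L (LinearMap.trace K V φ) :=
    LinearMap.trace_baseChange φ L
  rw [← isIntegral_algebraMap_iff (algebraMap K L).injective, ← htr,
    Module.End.trace_eq_sum_roots_charpoly_of_splits (IsAlgClosed.splits _)]
  refine IsIntegral.multiset_sum fun μ hμ => ?_
  obtain ⟨p, hp, hpψ⟩ := hψ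
  refine ⟨p, hp, ?_⟩
  have hev : ψ.HasEigenvalue μ := by
    rw [Module.End.hasEigenvalue_iff_isRoot_charpoly]
    exact Polynomial.isRoot_of_mem_roots hμ
  obtain ⟨x, hx⟩ := hev.exists_hasEigenvector
  have h := Module.End.aeval_apply_of_hasEigenvector (p := p.map (algebraMap A L)) hx
  rw [Polynomial.aeval_map_algebraMap, Polynomial.aeval_def, hpψ, LinearMap.zero_apply, eq_comm,
    smul_eq_zero, Polynomial.eval_map] at h
  exact h.resolve_right hx.2

/-- Over an integrally closed domain every finitely generated module carries a trace form with
values in the ring. -/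
theorem exists_trace_of_isIntegrallyClosed (A M : Type*) [CommRing A] [IsDomain A]
    [IsIntegrallyClosed A] [AddCommGroup M] [Module A M] [Module.Finite A M] :
    ∃ tr : Module.End A M →ₗ[A] A, ∀ (f : M →ₗ[A] A) (m : M), tr (f.smulRight m) = f m := by
  let K := FractionRing A
  let T : Module.End A M →ₗ[A] K :=
    (LinearMap.trace K (K ⊗[A] M)).restrictScalars A ∘ₗ LinearMap.baseChangeHom A K M M
  have hT (a) : T a ∈ LinearMap.range (Algebra.linearMap A K) := by
    have : IsIntegral A (Module.End.baseChangeHom A K M a) :=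
      (Algebra.IsIntegral.isIntegral (R := A) a).map (Module.End.baseChangeHom A K M)
    exact IsIntegrallyClosed.isIntegral_iff.mp (LinearMap.isIntegral_trace _ this)
  obtain ⟨tr, htr⟩ := LinearMap.exists_comp_eq_of_exact_injective (p := Submodule.mkQ _)
    (i := Algebra.linearMap A K) (IsFractionRing.injective A K)
    (LinearMap.exact_map_mkQ_range _) T (by ext a; simpa using hT a)
  refine ⟨tr, fun f m => IsFractionRing.injective A K ?_⟩
  have h1 : algebraMap A K (tr (f.smulRight m)) = T (f.smulRight m) := LinearMap.congr_fun htr _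
  rw [h1]
  have h2 : (f.smulRight m).baseChange K =
      ((TensorProduct.AlgebraTensorModule.rid A K K).toLinearMap ∘ₗ f.baseChange K).smulRight
        (1 ⊗ₜ[A] m) := by
    ext x
    simp [TensorProduct.smul_tmul']
  simp only [T, LinearMap.comp_apply, LinearMap.restrictScalars_apply,
    LinearMap.baseChangeHom_apply, h2]
  rw [LinearMap.trace_smulRight]
  simp [Algebra.smul_def]

theorem IsLocalRing.exists_minimal_cover (A M : Type*) [CommRing A] [IsLocalRing A] [AddCommGroup M]
    [Module A M] [Module.Finite A M] :
    ∃ (n : ℕ) (π : (Fin n → A) →ₗ[A] M), Function.Surjective π ∧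
      ∀ x, π x = 0 → ∀ i, x i ∈ maximalIdeal A := by
  let : Field (A ⧸ maximalIdeal A) := Ideal.Quotient.field _
  let Q := M ⧸ (maximalIdeal A • ⊤ : Submodule A M)
  have : Module.Finite (A ⧸ maximalIdeal A) Q := Module.Finite.of_restrictScalars_finite A _ _
  let b := Module.finBasis (A ⧸ maximalIdeal A) Q
  choose m hm using fun i => Submodule.mkQ_surjective (maximalIdeal A • ⊤ : Submodule A M) (b i)
  have key (x : Fin _ → A) : Submodule.mkQ _ (Fintype.linearCombination A m x) =
      ∑ i, Ideal.Quotient.mk (maximalIdeal A) (x i) • b i := by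
    simp only [Fintype.linearCombination_apply, map_sum, map_smul, hm]
    rfl
  refine ⟨_, Fintype.linearCombination A m, ?_, fun x hx i => ?_⟩
  · rw [← LinearMap.range_eq_top, eq_top_iff]
    refine Submodule.le_of_le_smul_of_le_jacobson_bot (I := maximalIdeal A) Module.Finite.fg_top
      (IsLocalRing.maximalIdeal_le_jacobson _) fun y _ => ?_
    choose c hc using fun i => Ideal.Quotient.mk_surjective (b.repr (Submodule.Quotient.mk y) i)
    have h1 := key c
    simp only [hc, b.sum_repr] at h1
    rw [← sub_add_cancel y (Fintype.linearCombination A m c), sup_comm]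
    refine Submodule.add_mem_sup ?_ (LinearMap.mem_range_self _ _)
    exact (Submodule.Quotient.eq _).mp h1.symm
  · have h1 := key x
    rw [hx, map_zero] at h1
    exact Ideal.Quotient.eq_zero_iff_mem.mp
      (Fintype.linearIndependent_iff.mp b.linearIndependent _ h1.symm i)

theorem Submodule.mem_smul_top_pi_iff {A ι : Type*} [CommRing A] [Fintype ι] (I : Ideal A)
    (x : ι → A) : x ∈ I • (⊤ : Submodule A (ι → A)) ↔ ∀ i, x i ∈ I := by
  classical
  refine ⟨fun h i => ?_, fun h => ?_⟩
  · have := Submodule.mem_map_of_mem (f := LinearMap.proj (R := A) (φ := fun _ : ι => A) i) h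
    rw [Submodule.map_smul''] at this
    exact Ideal.mul_le_left (J := ⊤) (Submodule.smul_mono le_rfl le_top this)
  · rw [pi_eq_sum_univ x]
    exact Submodule.sum_mem _ fun i _ => Submodule.smul_mem_smul (h i) trivial

namespace FreeResolution

open RingTheory.Sequence

/-- An element of the kernel of a minimal cover which represents a nonzero socle element
modulo a primary ideal. -/
theorem exists_socle_element {A M : Type*} [CommRing A] [IsLocalRing A] [IsNoetherianRing A]
    [AddCommGroup M] [Module A M] {n : ℕ} {π : (Fin n → A) →ₗ[A] M} (hπ : Function.Surjective π)
    (hker : LinearMap.ker π ≠ ⊥) {rs : List A} (hrsM : IsWeaklyRegular M rs)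
    (hle : Ideal.ofList rs ≤ maximalIdeal A) {t : ℕ} (ht : maximalIdeal A ^ t ≤ Ideal.ofList rs) :
    ∃ v, π v = 0 ∧ (∃ i, v i ∉ Ideal.ofList rs) ∧
      ∀ c ∈ maximalIdeal A, ∀ i, c * v i ∈ Ideal.ofList rs := by
  classical
  set K := LinearMap.ker π
  set I := Ideal.ofList rs
  have hex : ∃ s, maximalIdeal A ^ s • K ≤ I • ⊤ := ⟨t, Submodule.smul_mono ht le_top⟩
  obtain ⟨s, hs, hmin⟩ : ∃ s, maximalIdeal A ^ s • K ≤ I • ⊤ ∧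
      ∀ r < s, ¬ maximalIdeal A ^ r • K ≤ I • ⊤ :=
    ⟨Nat.find hex, Nat.find_spec hex, fun _ => Nat.find_min hex⟩
  cases s with
  | zero =>
    refine absurd ?_ hker
    rw [pow_zero, Ideal.one_eq_top, Submodule.top_smul] at hs
    have : (⊤ : Submodule A K) ≤ maximalIdeal A • ⊤ := fun x _ =>
      Submodule.smul_mono hle le_rfl (hrsM.mem_smul_top_of_exact K.subtype_injective
        (LinearMap.exact_subtype_ker_map π) hπ (hs x.2))
    have := Submodule.eq_bot_of_le_smul_of_le_jacobson_bot _ _ Module.Finite.fg_top this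
      (IsLocalRing.maximalIdeal_le_jacobson _)
    exact (Submodule.subsingleton_iff_eq_bot).mp ((Submodule.subsingleton_iff A).mp
      (subsingleton_of_bot_eq_top this.symm))
  | succ s =>
    obtain ⟨v, hv, hvI⟩ := SetLike.not_le_iff_exists.mp (hmin s s.lt_succ_self)
    refine ⟨v, Submodule.smul_le_right hv, ?_, fun c hc => ?_⟩
    · rwa [Submodule.mem_smul_top_pi_iff, not_forall] at hvI
    · refine (Submodule.mem_smul_top_pi_iff I (c • v)).mp (hs ?_)
      rw [pow_succ', mul_smul]
      exact Submodule.smul_mem_smul hc hv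

theorem Acyclic.projective_of_isWeaklyRegular {A M : Type} [CommRing A] [IsLocalRing A]
    [IsNoetherianRing A] [IsDomain A] [IsIntegrallyClosed A] [AddCommGroup M] [Module A M]
    [Module.Finite A M] {P : FreeResolution A M} (hA : P.Acyclic A) (hM : P.Acyclic M) {rs : List A}
    (hrsA : IsWeaklyRegular A rs) (hrsM : IsWeaklyRegular M rs)
    (hle : Ideal.ofList rs ≤ maximalIdeal A) {t : ℕ} (ht : maximalIdeal A ^ t ≤ Ideal.ofList rs) :
    Module.Projective A M := by
  obtain ⟨n, π, hπ, hmin⟩ := IsLocalRing.exists_minimal_cover A M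
  by_cases hker : LinearMap.ker π = ⊥
  · exact Module.Projective.of_equiv
      (LinearEquiv.ofBijective π ⟨LinearMap.ker_eq_bot.mp hker, hπ⟩)
  exfalso
  obtain ⟨v, hv, ⟨k, hk⟩, hsoc⟩ := exists_socle_element hπ hker hrsM hle ht
  set I := Ideal.ofList rs
  have hG (j) : ∃ G : M →ₗ[A] A, ∀ y, G (π y) - y k * v j ∈ I := by
    obtain ⟨g, hg⟩ := π.exists_comp_eq_of_ker_le hπ
      (Submodule.mkQ I ∘ₗ (LinearMap.proj k).smulRight (v j)) fun y hy => by
        exact (Submodule.Quotient.mk_eq_zero I).mpr (hsoc _ (hmin y hy k) j)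
    obtain ⟨G, rfl⟩ := hA.exists_lift_of_isWeaklyRegular hrsA (Submodule.mkQ I)
      (Submodule.mkQ_surjective _) (by simp [I]) g
    exact ⟨G, fun y => (Submodule.Quotient.eq _).mp (LinearMap.congr_fun hg y)⟩
  choose G hG using hG
  let a : Module.End A M := ∑ j, (G j).smulRight (π (Pi.single j 1))
  have hsum (y : Fin n → A) : ∑ j, y j • π (Pi.single j 1) = π y := by
    rw [π.pi_apply_eq_sum_univ y]
    congr! 4 with j _ i
    simp [Pi.single_apply, eq_comm]
  have ha : a ∈ I • (⊤ : Submodule A (Module.End A M)) := by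
    refine hM.mem_ofList_smul_top hrsM a fun x => ?_
    obtain ⟨y, rfl⟩ := hπ x
    have h1 : a (π y) = ∑ j, (G j (π y) - y k * v j) • π (Pi.single j 1) + y k • π v := by
      rw [← hsum v, Finset.smul_sum, ← Finset.sum_add_distrib]
      simp [a, sub_smul, mul_smul]
    rw [h1, hv, smul_zero, add_zero]
    exact Submodule.sum_mem _ fun j _ => Submodule.smul_mem_smul (hG j y) trivial
  obtain ⟨tr, htr⟩ := exists_trace_of_isIntegrallyClosed A M
  have h2 : tr a ∈ I := by
    have := Submodule.mem_map_of_mem (f := tr) ha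
    rw [Submodule.map_smul''] at this
    exact Ideal.mul_le_left (J := ⊤) (Submodule.smul_mono le_rfl le_top this)
  have h3 : tr a =
      ∑ j, (G j (π (Pi.single j 1)) - Pi.single (M := fun _ => A) j 1 k * v j) + v k := by
    simp [a, htr, Finset.sum_sub_distrib, Pi.single_apply]
  refine hk ((Submodule.add_mem_iff_right _ ?_).mp (h3 ▸ h2))
  exact Submodule.sum_mem _ fun j _ => hG j _

end FreeResolution

open RingTheory.Sequence in
theorem RingTheory.Sequence.IsWeaklyRegular.of_flat_module {R F : Type*} [CommRing R]
    [AddCommGroup F] [Module R F] [Module.Flat R F] {rs : List R} (h : IsWeaklyRegular R rs) :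
    IsWeaklyRegular F rs :=
  ((TensorProduct.rid R F).isWeaklyRegular_congr rs).mp h.isWeaklyRegular_lTensor

namespace FreeResolution

open RingTheory.Sequence

theorem Acyclic.projective_of_isWeaklyRegular_append {A M : Type} [CommRing A] [IsLocalRing A]
    [IsNoetherianRing A] [IsDomain A] [IsIntegrallyClosed A] [AddCommGroup M] [Module A M]
    [Module.Finite A M] {P : FreeResolution A M} (hA : P.Acyclic A) (hM : P.Acyclic M)
    {rs₁ rs₂ : List A} (hrsA : IsWeaklyRegular A (rs₁ ++ rs₂)) (hrsM : IsWeaklyRegular M rs₁)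
    (hle : Ideal.ofList (rs₁ ++ rs₂) ≤ maximalIdeal A) {t : ℕ}
    (ht : maximalIdeal A ^ t ≤ Ideal.ofList (rs₁ ++ rs₂)) : Module.Projective A M := by
  induction rs₂ generalizing rs₁ M with
  | nil =>
    rw [List.append_nil] at hrsA hle ht
    exact hA.projective_of_isWeaklyRegular hM hrsA hrsM hle ht
  | cons x rs₂ ih =>
    rw [List.append_cons] at hrsA hle ht
    have hF : IsWeaklyRegular (P.F 0) (rs₁ ++ [x]) :=
      ((isWeaklyRegular_append_iff A _ _).mp hrsA).1.of_flat_module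
    have := ih hA.syzygy (hA.syzygy_ker hM) hrsA
      (hrsM.concat_of_exact (Submodule.subtype_injective _)
        (LinearMap.exact_subtype_ker_map P.ε) P.ε_surjective hF) hle ht
    exact hA.projective

end FreeResolution

open RingTheory.Sequence in
theorem IsCMLocal.exists_isWeaklyRegular {A : Type} [CommRing A] [IsLocalRing A]
    [IsNoetherianRing A] (h : IsCMLocal A) :
    ∃ rs : List A, IsWeaklyRegular A rs ∧ Ideal.ofList rs ≤ maximalIdeal A ∧
      ∃ t, maximalIdeal A ^ t ≤ Ideal.ofList rs := by
  obtain ⟨d, hd⟩ : ∃ d : ℕ, ringKrullDim A = d := by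
    have htop := ringKrullDim_ne_top (R := A)
    obtain ⟨e, he⟩ := WithBot.ne_bot_iff_exists.mp (ringKrullDim_ne_bot (R := A))
    rw [← he] at htop ⊢
    have htop' : e ≠ ⊤ := fun h => htop (by rw [h]; rfl)
    obtain ⟨d, rfl⟩ := ENat.ne_top_iff_exists.mp htop'
    exact ⟨d, rfl⟩
  have hdepth : moduleDepth A A = d := by
    rw [IsCMLocal, hd] at h
    exact_mod_cast h
  have hext (i : ℕ) (hi : i < d) : Subsingleton
      (Abelian.Ext (ModuleCat.of A (A ⧸ maximalIdeal A)) (ModuleCat.of A A) i) := by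
    refine subsingleton_abelianExt_of_subsingleton_Ext i _ _ ?_
    by_contra hn
    have : moduleDepth A A ≤ i := sInf_le ⟨i, rfl, not_subsingleton_iff_nontrivial.mp hn⟩
    rw [hdepth] at this
    exact absurd hi (not_lt.mpr (by exact_mod_cast this))
  obtain ⟨rs, hlen, hmem, hreg⟩ := ModuleCat.exists_isRegular_of_exists_subsingleton_ext
    (maximalIdeal A) d (ModuleCat.of A A) (by
      rw [Ideal.smul_top_eq_map]
      simpa [lt_top_iff_ne_top] using Ideal.IsPrime.ne_top')
    (ModuleCat.of A (A ⧸ maximalIdeal A))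
    (by rw [Module.support_eq_zeroLocus, Ideal.annihilator_quotient]) hext
  have hle : Ideal.ofList rs ≤ maximalIdeal A := Ideal.span_le.mpr hmem
  refine ⟨rs, hreg.toIsWeaklyRegular, hle, ?_⟩
  have hdim := ringKrullDim_add_length_eq_ringKrullDim_of_isRegular rs hreg
  rw [hd, hlen] at hdim
  have : Ring.KrullDimLE 0 (A ⧸ Ideal.ofList rs) := by
    rw [Ring.krullDimLE_iff]
    generalize ringKrullDim (A ⧸ Ideal.ofList rs) = e at hdim
    induction e with
    | bot => exact bot_le
    | coe e =>
      have h1 : e + d = 0 + d := by rw [zero_add]; exact_mod_cast hdim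
      rw [(ENat.add_left_injective_of_ne_top (ENat.natCast_ne_top d)) h1]
      rfl
  have := isArtinianRing_iff_isNoetherianRing_krullDimLE_zero.mpr
    ⟨inferInstanceAs (IsNoetherianRing (A ⧸ Ideal.ofList rs)), this⟩
  exact exists_maximalIdeal_pow_le_of_isArtinianRing_quotient _

/-- The Auslander–Reiten conjecture holds for Cohen–Macaulay normal rings: a finitely
generated module `M` with `Ext^{>0}(M, M ⊕ R) = 0` is projective. -/
theorem auslander_reiten_for_cm_normal (R : Type) [CommRing R] [IsNoetherianRing R]
    (hCM : ∀ p : PrimeSpectrum R, IsCMLocal (Localization.AtPrime p.asIdeal))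
    (hnormal : ∀ p : PrimeSpectrum R, IsDomain (Localization.AtPrime p.asIdeal) ∧
      IsIntegrallyClosed (Localization.AtPrime p.asIdeal))
    (M : Type) [AddCommGroup M] [Module R M] [Module.Finite R M]
    (hext : ∀ i : ℕ, 0 < i → Subsingleton (extGroup R i M (M × R))) :
    Module.Projective R M := by
  obtain ⟨P⟩ := FreeResolution.nonempty (R := R) M
  have hP : P.Acyclic (M × R) := FreeResolution.acyclic_of_subsingleton_ext P (M × R) fun i hi =>
    subsingleton_abelianExt_of_subsingleton_Ext i _ _ (hext i hi)
  have hPM : P.Acyclic M := hP.of_retract (.inl R M R) (.fst R M R) (LinearMap.fst_comp_inl ..)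
  have hPR : P.Acyclic R := hP.of_retract (.inr R M R) (.snd R M R) (LinearMap.snd_comp_inr ..)
  have := Module.finitePresentation_of_finite R M
  refine Module.projective_of_localization_maximal fun m hm => ?_
  let p : PrimeSpectrum R := ⟨m, hm.isPrime⟩
  have := (hnormal p).1
  have := (hnormal p).2
  have : IsNoetherianRing (Localization.AtPrime m) := inferInstance
  obtain ⟨rs, hrs, hle, t, ht⟩ := (hCM p).exists_isWeaklyRegular
  exact FreeResolution.Acyclic.projective_of_isWeaklyRegular_append (rs₁ := []) (rs₂ := rs)
    (P := P.localization m.primeCompl) (hPR.localization _) (hPM.localization _) hrs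
    (.nil _ _) hle ht
end

section
/- Let R be a d-dimensional Noetherian Cohen–Macaulay ring such that R_p is a complete intersection for every prime p of height at most 1. Let M be a finitely generated R-module satisfying Ext^i_R(M, R) = 0 for all 1 ≤ i ≤ 2d+1 and Ext^j_R(M, M) = 0 for all 1 ≤ j ≤ max{2, d−1}. Then M is projective. -/
open CategoryTheory TensorProduct IsLocalRing

/-- A regular local ring: the maximal ideal is generated by `dim` many elements. -/
def IsRegularLocal (S : Type) [CommRing S] [IsLocalRing S] : Prop :=
  ∃ s : Finset S, Ideal.span (s : Set S) = IsLocalRing.maximalIdeal S ∧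
    (s.card : WithBot ℕ∞) = ringKrullDim S

/-- A local ring is a complete intersection if its maximal-adic completion is a regular local
ring modulo an ideal generated by a regular sequence. -/
def IsCompleteIntersectionLocal (A : Type) [CommRing A] [IsLocalRing A] : Prop :=
  ∃ (S : Type) (_ : CommRing S) (_ : IsLocalRing S) (_ : IsNoetherianRing S) (rs : List S),
    IsRegularLocal S ∧ RingTheory.Sequence.IsRegular S rs ∧
    (∀ x ∈ rs, x ∈ IsLocalRing.maximalIdeal S) ∧
    Nonempty ((AdicCompletion (IsLocalRing.maximalIdeal A) A) ≃+* S ⧸ Ideal.span {x | x ∈ rs})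


section ExtVanishing

variable {R : Type} [CommRing R]

/-- The `n`-th Ext group of `M` and `N` is trivial. -/
def ExtVanishes (R : Type) [CommRing R] (n : ℕ) (M N : Type) [AddCommGroup M] [Module R M]
    [AddCommGroup N] [Module R N] : Prop :=
  Subsingleton (Abelian.Ext.{0} (ModuleCat.of R M) (ModuleCat.of R N) n)

variable {A B C X Y : Type} [AddCommGroup A] [Module R A] [AddCommGroup B] [Module R B]
  [AddCommGroup C] [Module R C] [AddCommGroup X] [Module R X] [AddCommGroup Y] [Module R Y]

lemma extVanishes_iff {n : ℕ} :
    ExtVanishes R n A B ↔ ∀ e : Abelian.Ext.{0} (ModuleCat.of R A) (ModuleCat.of R B) n, e = 0 :=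
  subsingleton_iff_forall_eq 0

lemma extVanishes_zero_iff : ExtVanishes R 0 A B ↔ ∀ f : A →ₗ[R] B, f = 0 := by
  rw [ExtVanishes, Abelian.Ext.homEquiv₀.subsingleton_congr, subsingleton_iff_forall_eq 0]
  exact ⟨fun h f ↦ by simpa using congrArg ModuleCat.Hom.hom (h (ModuleCat.ofHom f)),
    fun h f ↦ by ext1; exact h f.hom⟩

section Bridge

lemma exactAt_linearYonedaObj_iff {Z : ModuleCat.{0} R} (P : ProjectiveResolution Z)
    (W : ModuleCat.{0} R) (n : ℕ) :
    (P.complex.linearYonedaObj R W).ExactAt (n + 1) ↔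
      ∀ f : P.complex.X (n + 1) ⟶ W, P.complex.d (n + 2) (n + 1) ≫ f = 0 →
        ∃ g : P.complex.X n ⟶ W, P.complex.d (n + 1) n ≫ g = f := by
  rw [HomologicalComplex.exactAt_iff' _ n (n + 1) (n + 2) (by simp) (by simp),
    ShortComplex.moduleCat_exact_iff]
  rfl

lemma subsingleton_extGroup_succ_iff {n : ℕ} :
    Subsingleton (extGroup R (n + 1) A B) ↔ ExtVanishes R (n + 1) A B := by
  let P := projectiveResolution (ModuleCat.of R A)
  have h := P.isoExt (R := R) (n + 1) (ModuleCat.of R B)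
  rw [extGroup, ← ModuleCat.isZero_iff_subsingleton, h.isZero_iff,
    ← HomologicalComplex.exactAt_iff_isZero_homology, exactAt_linearYonedaObj_iff,
    extVanishes_iff]
  constructor
  · intro H e
    obtain ⟨f, hf, rfl⟩ := P.extMk_surjective e (n + 2) rfl
    exact (P.extMk_eq_zero_iff f (n + 2) rfl hf n rfl).2 (H f hf)
  · intro H f hf
    exact (P.extMk_eq_zero_iff f (n + 2) rfl hf n rfl).1 (H _)

lemma subsingleton_extGroup_zero_iff :
    Subsingleton (extGroup R 0 A B) ↔ ExtVanishes R 0 A B := by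
  let P := projectiveResolution (ModuleCat.of R A)
  have h := P.isoExt (R := R) 0 (ModuleCat.of R B)
  rw [extGroup, ← ModuleCat.isZero_iff_subsingleton, h.isZero_iff,
    ← HomologicalComplex.exactAt_iff_isZero_homology, extVanishes_zero_iff,
    HomologicalComplex.exactAt_iff' _ 0 0 1 (by simp) (by simp),
    ShortComplex.moduleCat_exact_iff]
  have key : ∀ f : P.complex.X 0 ⟶ ModuleCat.of R B, P.complex.d 1 0 ≫ f = 0 →
      ∃ g : ModuleCat.of R A ⟶ ModuleCat.of R B, P.π.f 0 ≫ g = f := fun f hf ↦ by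
    have := P.isColimitCokernelCofork
    exact ⟨_, Limits.IsColimit.fac this (Limits.CokernelCofork.ofπ f hf) .one⟩
  have hd : (P.complex.linearYonedaObj R (ModuleCat.of R B)).d 0 0 = 0 :=
    HomologicalComplex.shape _ _ _ (by simp)
  have hepi : Epi (P.π.f 0) := inferInstance
  constructor
  · intro H f
    obtain ⟨g, hg⟩ := H (P.π.f 0 ≫ ModuleCat.ofHom f) (by
      change P.complex.d 1 0 ≫ P.π.f 0 ≫ ModuleCat.ofHom f = 0
      exact (Category.assoc _ _ _).symm.trans
        ((congrArg (· ≫ ModuleCat.ofHom f) P.complex_d_comp_π_f_zero).trans Limits.zero_comp))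
    have h0 : P.π.f 0 ≫ ModuleCat.ofHom f = 0 := by
      rw [← hg]
      exact congrArg (fun φ ↦ φ.hom g) hd
    have := (cancel_epi (P.π.f 0)).1 (h0.trans (Limits.comp_zero (f := P.π.f 0)).symm)
    exact congrArg ModuleCat.Hom.hom this
  · intro H f hf
    obtain ⟨g, rfl⟩ := key f hf
    refine ⟨0, (map_zero _).trans ?_⟩
    have : g = 0 := by ext1; exact H g.hom
    rw [this]
    exact (Limits.comp_zero (f := P.π.f 0)).symm

lemma subsingleton_extGroup_iff {n : ℕ} :
    Subsingleton (extGroup R n A B) ↔ ExtVanishes R n A B := by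
  cases n with
  | zero => exact subsingleton_extGroup_zero_iff
  | succ n => exact subsingleton_extGroup_succ_iff

end Bridge

section LongExactSequence

variable {f : A →ₗ[R] B} {g : B →ₗ[R] C} (hf : Function.Injective f) (hfg : Function.Exact f g)
  (hg : Function.Surjective g)

include hf hfg hg in
lemma shortExact_of_linearMap :
    (ModuleCat.shortComplexOfCompEqZero f g hfg.linearMap_comp_eq_zero).ShortExact :=
  ModuleCat.shortComplex_shortExact _ hfg hf hg

include hf hfg hg

lemma ExtVanishes.contra_mid {n : ℕ} (hA : ExtVanishes R n A Y) (hC : ExtVanishes R n C Y) :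
    ExtVanishes R n B Y := by
  rw [extVanishes_iff] at *
  intro e
  obtain ⟨x, rfl⟩ := Abelian.Ext.contravariant_sequence_exact₂
    (shortExact_of_linearMap hf hfg hg) _ e (hA _)
  rw [hC x, Abelian.Ext.comp_zero]

lemma ExtVanishes.contra_left {n : ℕ} (hB : ExtVanishes R n B Y)
    (hC : ExtVanishes R (n + 1) C Y) : ExtVanishes R n A Y := by
  rw [extVanishes_iff] at *
  intro e
  obtain ⟨x, rfl⟩ := Abelian.Ext.contravariant_sequence_exact₁
    (shortExact_of_linearMap hf hfg hg) _ e (add_comm 1 n) (hC _)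
  rw [hB x, Abelian.Ext.comp_zero]

lemma ExtVanishes.contra_right {n : ℕ} (hA : ExtVanishes R n A Y)
    (hB : ExtVanishes R (n + 1) B Y) : ExtVanishes R (n + 1) C Y := by
  rw [extVanishes_iff] at *
  intro e
  obtain ⟨x, rfl⟩ := Abelian.Ext.contravariant_sequence_exact₃
    (shortExact_of_linearMap hf hfg hg) _ e (hB _) (add_comm 1 n)
  rw [hA x, Abelian.Ext.comp_zero]

lemma ExtVanishes.cov_mid {n : ℕ} (hA : ExtVanishes R n X A) (hC : ExtVanishes R n X C) :
    ExtVanishes R n X B := by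
  rw [extVanishes_iff] at *
  intro e
  obtain ⟨x, rfl⟩ := Abelian.Ext.covariant_sequence_exact₂ _
    (shortExact_of_linearMap hf hfg hg) e (hC _)
  rw [hA x, Abelian.Ext.zero_comp]

lemma ExtVanishes.cov_left {n : ℕ} (hC : ExtVanishes R n X C)
    (hB : ExtVanishes R (n + 1) X B) : ExtVanishes R (n + 1) X A := by
  rw [extVanishes_iff] at *
  intro e
  obtain ⟨x, rfl⟩ := Abelian.Ext.covariant_sequence_exact₁ _
    (shortExact_of_linearMap hf hfg hg) e (hB _) rfl
  rw [hC x, Abelian.Ext.zero_comp]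

/-- A map from the subobject extends when `Ext¹` of the quotient vanishes. -/
lemma ExtVanishes.exists_extend (hC : ExtVanishes R 1 C Y) (u : A →ₗ[R] Y) :
    ∃ v : B →ₗ[R] Y, v ∘ₗ f = u := by
  obtain ⟨x, hx⟩ := Abelian.Ext.contravariant_sequence_exact₁
    (shortExact_of_linearMap hf hfg hg) _ (Abelian.Ext.mk₀ (ModuleCat.ofHom u)) (add_zero 1)
    (extVanishes_iff.1 hC _)
  obtain ⟨v, rfl⟩ := (Abelian.Ext.mk₀_bijective _ _).2 x
  rw [Abelian.Ext.mk₀_comp_mk₀] at hx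
  have := (Abelian.Ext.mk₀_bijective _ _).1 hx
  exact ⟨v.hom, congrArg ModuleCat.Hom.hom this⟩

/-- If maps from the subobject extend and `Ext¹` of the middle term vanishes, then `Ext¹` of the
quotient vanishes. -/
lemma extVanishes_one_of_extend (hB : ExtVanishes R 1 B Y)
    (H : ∀ u : A →ₗ[R] Y, ∃ v : B →ₗ[R] Y, v ∘ₗ f = u) : ExtVanishes R 1 C Y := by
  have hS := shortExact_of_linearMap hf hfg hg
  rw [extVanishes_iff] at *
  intro e
  obtain ⟨x, rfl⟩ := Abelian.Ext.contravariant_sequence_exact₃ hS _ e (hB _) (add_zero 1)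
  obtain ⟨u, rfl⟩ := (Abelian.Ext.mk₀_bijective _ _).2 x
  obtain ⟨v, hv⟩ := H u.hom
  have hu : u = ModuleCat.ofHom f ≫ ModuleCat.ofHom v := by ext1; exact hv.symm
  rw [hu, ← Abelian.Ext.mk₀_comp_mk₀]
  exact hS.extClass_comp_assoc _

end LongExactSequence

lemma extVanishes_of_projective [Module.Projective R A] (n : ℕ) : ExtVanishes R (n + 1) A B := by
  have : Projective (ModuleCat.of R A) := (IsProjective.iff_projective A).1 inferInstance
  exact extVanishes_iff.2 fun e ↦ Abelian.Ext.eq_zero_of_projective e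

lemma extVanishes_of_subsingleton_left [Subsingleton A] (n : ℕ) : ExtVanishes R n A B := by
  cases n with
  | zero => exact extVanishes_zero_iff.2 fun f ↦ Subsingleton.elim _ _
  | succ n => exact extVanishes_of_projective n

lemma extVanishes_of_subsingleton_right [Subsingleton B] (n : ℕ) : ExtVanishes R n A B := by
  refine extVanishes_iff.2 fun e ↦ ?_
  have h : 𝟙 (ModuleCat.of R B) = 0 := by ext x; exact Subsingleton.elim (α := B) _ _
  rw [← Abelian.Ext.comp_mk₀_id e, h, Abelian.Ext.mk₀_zero, Abelian.Ext.comp_zero]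

lemma LinearEquiv.exact_zero_punit (e : A ≃ₗ[R] X) :
    Function.Exact e.toLinearMap (0 : X →ₗ[R] PUnit.{1}) :=
  fun x ↦ ⟨fun _ ↦ e.surjective x, fun _ ↦ rfl⟩

lemma ExtVanishes.congr {n : ℕ} (h : ExtVanishes R n A B) (e₁ : A ≃ₗ[R] X) (e₂ : B ≃ₗ[R] Y) :
    ExtVanishes R n X Y :=
  (h.contra_mid e₁.injective e₁.exact_zero_punit (fun _ ↦ ⟨0, rfl⟩)
    (extVanishes_of_subsingleton_left n)).cov_mid e₂.injective e₂.exact_zero_punit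
      (fun _ ↦ ⟨0, rfl⟩) (extVanishes_of_subsingleton_right n)

lemma ExtVanishes.left_succ_iff {n : ℕ} {f : A →ₗ[R] B} {g : B →ₗ[R] C}
    (hf : Function.Injective f) (hfg : Function.Exact f g) (hg : Function.Surjective g)
    [Module.Projective R B] :
    ExtVanishes R (n + 1) A Y ↔ ExtVanishes R (n + 2) C Y :=
  ⟨fun h ↦ h.contra_right hf hfg hg (extVanishes_of_projective _),
    fun h ↦ (extVanishes_of_projective _).contra_left hf hfg hg h⟩

lemma ExtVanishes.prod_left {n : ℕ} (hA : ExtVanishes R n A Y) (hB : ExtVanishes R n B Y) :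
    ExtVanishes R n (A × B) Y :=
  hA.contra_mid (LinearMap.inl_injective (R := R) (M := A) (M₂ := B))
    .inl_snd LinearMap.snd_surjective hB

lemma ExtVanishes.prod_right {n : ℕ} (hA : ExtVanishes R n Y A) (hB : ExtVanishes R n Y B) :
    ExtVanishes R n Y (A × B) :=
  hA.cov_mid (LinearMap.inl_injective (R := R) (M := A) (M₂ := B))
    .inl_snd LinearMap.snd_surjective hB

lemma ExtVanishes.pi_right {n : ℕ} (hA : ExtVanishes R n Y A) (k : ℕ) :
    ExtVanishes R n Y (Fin k → A) := by
  induction k with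
  | zero => exact extVanishes_of_subsingleton_right n
  | succ k ih => exact (hA.prod_right ih).congr (.refl R Y) (Fin.consLinearEquiv R fun _ ↦ A)

lemma ExtVanishes.pi_left {n : ℕ} (hA : ExtVanishes R n A Y) (k : ℕ) :
    ExtVanishes R n (Fin k → A) Y := by
  induction k with
  | zero => exact extVanishes_of_subsingleton_left n
  | succ k ih => exact (hA.prod_left ih).congr (Fin.consLinearEquiv R fun _ ↦ A) (.refl R Y)

end ExtVanishing

section FlatBaseChange

variable {A : Type} [CommRing A] [IsNoetherianRing A] (C : Type) [CommRing C] [Algebra A C]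
  [Module.Flat A C]

lemma LinearMap.baseChange_extend {K F N : Type} [AddCommGroup K] [Module A K] [Module.Finite A K]
    [AddCommGroup F] [Module A F] [AddCommGroup N] [Module A N] (f : K →ₗ[A] F)
    (H : ∀ u : K →ₗ[A] N, ∃ v : F →ₗ[A] N, v ∘ₗ f = u) (u : C ⊗[A] K →ₗ[C] C ⊗[A] N) :
    ∃ v : C ⊗[A] F →ₗ[C] C ⊗[A] N, v ∘ₗ f.baseChange C = u := by
  have : Module.FinitePresentation A K := Module.finitePresentation_of_finite A K
  refine (Module.FinitePresentation.isBaseChange_map A K N C).inductionOn u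
    (motive := fun u ↦ ∃ v, v ∘ₗ f.baseChange C = u) ⟨0, LinearMap.zero_comp _⟩ ?_ ?_ ?_
  · intro u
    obtain ⟨v, rfl⟩ := H u
    exact ⟨v.baseChange C, (LinearMap.baseChange_comp f v).symm⟩
  · rintro c _ ⟨v, rfl⟩
    exact ⟨c • v, LinearMap.smul_comp _ _ _⟩
  · rintro _ _ ⟨v, rfl⟩ ⟨w, rfl⟩
    exact ⟨v + w, LinearMap.add_comp _ _ _⟩

lemma ExtVanishes.baseChange {M N : Type} [AddCommGroup M] [Module A M] [Module.Finite A M]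
    [AddCommGroup N] [Module A N] {i : ℕ} (h : ExtVanishes A (i + 1) M N) :
    ExtVanishes C (i + 1) (C ⊗[A] M) (C ⊗[A] N) := by
  induction i generalizing M with
  | zero =>
    obtain ⟨n, π, hπ⟩ := Module.Finite.exists_fin' A M
    have hex : Function.Exact (LinearMap.ker π).subtype π := LinearMap.exact_subtype_ker_map π
    have hinj := (LinearMap.ker π).injective_subtype
    refine extVanishes_one_of_extend (f := (LinearMap.ker π).subtype.baseChange C)
      (g := π.baseChange C) (Module.Flat.lTensor_preserves_injective_linearMap _ hinj)
      (lTensor_exact C hex hπ) (LinearMap.lTensor_surjective C hπ) (extVanishes_of_projective 0) ?_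
    exact LinearMap.baseChange_extend C _ (h.exists_extend hinj hex hπ)
  | succ i ih =>
    obtain ⟨n, π, hπ⟩ := Module.Finite.exists_fin' A M
    have hex : Function.Exact (LinearMap.ker π).subtype π := LinearMap.exact_subtype_ker_map π
    have hinj := (LinearMap.ker π).injective_subtype
    rw [← ExtVanishes.left_succ_iff hinj hex hπ] at h
    exact (ExtVanishes.left_succ_iff (f := (LinearMap.ker π).subtype.baseChange C)
      (g := π.baseChange C) (Module.Flat.lTensor_preserves_injective_linearMap _ hinj)
      (lTensor_exact C hex hπ) (LinearMap.lTensor_surjective C hπ)).1 (ih h)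

end FlatBaseChange

section FactorIdeal

variable {A : Type} [CommRing A]

/-- The ideal of those `s` such that multiplication by `s` on `M` factors through a finite free
module. -/
def freeFactorIdeal (A M : Type) [CommRing A] [AddCommGroup M] [Module A M] : Ideal A :=
  (LinearMap.range (dualTensorHom A M M)).comap
    (LinearMap.toSpanSingleton A (M →ₗ[A] M) LinearMap.id)

variable {K F M N P : Type} [AddCommGroup K] [Module A K] [AddCommGroup F] [Module A F]
  [AddCommGroup M] [Module A M] [AddCommGroup N] [Module A N] [AddCommGroup P] [Module A P]

lemma mem_freeFactorIdeal {s : A} :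
    s ∈ freeFactorIdeal A M ↔ s • LinearMap.id ∈ LinearMap.range (dualTensorHom A M M) :=
  Iff.rfl

lemma comp_mem_range_dualTensorHom_left (g : N →ₗ[A] P) {f : M →ₗ[A] N}
    (hf : f ∈ LinearMap.range (dualTensorHom A M N)) :
    g ∘ₗ f ∈ LinearMap.range (dualTensorHom A M P) := by
  obtain ⟨x, rfl⟩ := hf
  refine ⟨g.lTensor _ x, ?_⟩
  induction x with
  | zero => simp
  | add x y hx hy => simp only [map_add, hx, hy, LinearMap.comp_add]
  | tmul φ m => ext; simp

lemma comp_mem_range_dualTensorHom_right {g : N →ₗ[A] P} (f : M →ₗ[A] N)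
    (hg : g ∈ LinearMap.range (dualTensorHom A N P)) :
    g ∘ₗ f ∈ LinearMap.range (dualTensorHom A M P) := by
  obtain ⟨x, rfl⟩ := hg
  refine ⟨f.dualMap.rTensor _ x, ?_⟩
  induction x with
  | zero => simp
  | add x y hx hy => simp only [map_add, hx, hy, LinearMap.add_comp]
  | tmul φ m => ext; simp

lemma mem_range_dualTensorHom_of_free [Module.Free A M] [Module.Finite A M] (f : M →ₗ[A] N) :
    f ∈ LinearMap.range (dualTensorHom A M N) :=
  (dualTensorHomEquiv A M N).surjective f

lemma exists_lift_of_mem_range_dualTensorHom {g : F →ₗ[A] N} (hg : Function.Surjective g)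
    {f : M →ₗ[A] N} (hf : f ∈ LinearMap.range (dualTensorHom A M N)) :
    ∃ h : M →ₗ[A] F, g ∘ₗ h = f := by
  obtain ⟨x, rfl⟩ := hf
  obtain ⟨y, rfl⟩ := LinearMap.lTensor_surjective (Module.Dual A M) hg x
  refine ⟨dualTensorHom A M F y, ?_⟩
  induction y with
  | zero => simp
  | add x y hx hy => simp only [map_add, hx, hy, LinearMap.comp_add]
  | tmul φ m => ext; simp

lemma projective_of_id_mem_range_dualTensorHom [Module.Finite A M]
    (h : LinearMap.id ∈ LinearMap.range (dualTensorHom A M M)) : Module.Projective A M := by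
  obtain ⟨n, π, hπ⟩ := Module.Finite.exists_fin' A M
  obtain ⟨i, hi⟩ := exists_lift_of_mem_range_dualTensorHom hπ h
  exact Module.Projective.of_split i π hi

lemma projective_of_freeFactorIdeal_eq_top [Module.Finite A M] (h : freeFactorIdeal A M = ⊤) :
    Module.Projective A M := by
  refine projective_of_id_mem_range_dualTensorHom ?_
  have h1 : (1 : A) ∈ freeFactorIdeal A M := h ▸ Submodule.mem_top
  simpa [mem_freeFactorIdeal] using h1

lemma id_mem_range_dualTensorHom_of_projective [Module.Finite A M] [Module.Projective A M] :
    LinearMap.id ∈ LinearMap.range (dualTensorHom A M M) := by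
  obtain ⟨n, π, hπ⟩ := Module.Finite.exists_fin' A M
  obtain ⟨i, hi⟩ := Module.projective_lifting_property π LinearMap.id hπ
  rw [← hi]
  exact comp_mem_range_dualTensorHom_right _ (mem_range_dualTensorHom_of_free π)

section Syzygy

variable {f : K →ₗ[A] F} {g : F →ₗ[A] M} (hf : Function.Injective f) (hfg : Function.Exact f g)
  (hg : Function.Surjective g)

include hf hfg hg

lemma exists_retraction_of_mem_freeFactorIdeal {s : A} (hs : s ∈ freeFactorIdeal A M) :
    ∃ θ : F →ₗ[A] K, θ ∘ₗ f = s • LinearMap.id := by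
  obtain ⟨β, hβ⟩ := exists_lift_of_mem_range_dualTensorHom hg (mem_freeFactorIdeal.1 hs)
  have hβ' : ∀ m, g (β m) = s • m := fun m ↦ LinearMap.congr_fun hβ m
  have hmem : ∀ x, s • x - β (g x) ∈ LinearMap.range f := fun x ↦ (hfg _).1 (by simp [hβ'])
  let e := LinearEquiv.ofInjective f hf
  let θ₀ : F →ₗ[A] LinearMap.range f :=
    (s • LinearMap.id - β ∘ₗ g).codRestrict (LinearMap.range f) hmem
  refine ⟨e.symm.toLinearMap ∘ₗ θ₀, LinearMap.ext fun x ↦ ?_⟩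
  have : θ₀ (f x) = e (s • x) := Subtype.ext (by simp [θ₀, e, hfg.apply_apply_eq_zero])
  simp [this]

lemma freeFactorIdeal_le_of_exact [Module.Free A F] [Module.Finite A F] :
    freeFactorIdeal A M ≤ freeFactorIdeal A K := fun s hs ↦ by
  obtain ⟨θ, hθ⟩ := exists_retraction_of_mem_freeFactorIdeal hf hfg hg hs
  rw [mem_freeFactorIdeal, ← hθ]
  exact comp_mem_range_dualTensorHom_right _ (mem_range_dualTensorHom_of_free θ)

lemma freeFactorIdeal_le_annihilator_ker_rTensor :
    freeFactorIdeal A M ≤ Module.annihilator A (LinearMap.ker (f.rTensor P)) := fun s hs ↦ by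
  obtain ⟨θ, hθ⟩ := exists_retraction_of_mem_freeFactorIdeal hf hfg hg hs
  rw [Module.mem_annihilator]
  rintro ⟨x, hx⟩
  have h : θ.rTensor P (f.rTensor P x) = s • x := by
    rw [← LinearMap.comp_apply, ← LinearMap.rTensor_comp, hθ]
    simp [LinearMap.rTensor_smul]
  rw [LinearMap.mem_ker.1 hx, map_zero] at h
  exact Subtype.ext h.symm

end Syzygy

lemma smul_eq_zero_of_dualTensorHom_eq_zero {s : A} (hs : s ∈ freeFactorIdeal A M)
    {x : Module.Dual A M ⊗[A] M} (hx : dualTensorHom A M M x = 0) : s • x = 0 := by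
  obtain ⟨z, hz⟩ := mem_freeFactorIdeal.1 hs
  have h0 : (0 : M →ₗ[A] M).dualMap = 0 := by ext; simp
  have hadd : ∀ u v : M →ₗ[A] M, (u + v).dualMap = u.dualMap + v.dualMap := fun u v ↦ by ext; simp
  have key : ∀ x z : Module.Dual A M ⊗[A] M, (dualTensorHom A M M x).dualMap.rTensor M z =
      (dualTensorHom A M M z).lTensor (Module.Dual A M) x := by
    intro x z
    induction x with
    | zero => simp [h0]
    | add x y hx hy =>
      rw [map_add, map_add, ← hx, ← hy, ← LinearMap.add_apply, ← LinearMap.rTensor_add, hadd]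
    | tmul ψ y =>
      induction z with
      | zero => simp
      | add x y hx hy => simp only [map_add, hx, hy, LinearMap.lTensor_add, LinearMap.add_apply]
      | tmul φ w =>
        have : (dualTensorHom A M M (ψ ⊗ₜ y)).dualMap φ = φ y • ψ := by
          ext m; simp [mul_comm]
        simp [this, TensorProduct.smul_tmul]
  have := key x z
  rw [hx, hz] at this
  simpa [h0, LinearMap.lTensor_smul] using this.symm

end FactorIdeal

section DepthVanishing

variable {A : Type} [CommRing A] [IsNoetherianRing A] [IsLocalRing A]

/-- If `Ext^i(k, A) = 0` for `i < t`, then `Ext^i(L, A) = 0` for `i < t` and every finitely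
generated `L` supported at the closed point. -/
lemma extVanishes_of_torsion {t : ℕ}
    (hk : ∀ i < t, ExtVanishes A i (A ⧸ maximalIdeal A) A) {L : Type} [AddCommGroup L]
    [Module A L] [Module.Finite A L] (hL : maximalIdeal A ≤ (Module.annihilator A L).radical)
    {i : ℕ} (hi : i < t) : ExtVanishes A i L A := by
  have hlt : maximalIdeal A • (⊤ : Submodule A A) < ⊤ := by
    rw [Ideal.smul_eq_mul, Ideal.mul_top]
    exact (IsLocalRing.maximalIdeal.isMaximal A).ne_top.lt_top
  obtain ⟨rs, hlen, hmem, hreg⟩ := ModuleCat.exists_isRegular_of_exists_subsingleton_ext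
    (maximalIdeal A) t (ModuleCat.of A A) hlt (ModuleCat.of A (A ⧸ maximalIdeal A))
    (by
      change Module.support A (A ⧸ maximalIdeal A) = _
      rw [Module.support_eq_zeroLocus, Ideal.annihilator_quotient]) hk
  refine ModuleCat.subsingleton_ext_of_exists_isRegular (maximalIdeal A) (ModuleCat.of A L) ?_
    (ModuleCat.of A A) hlt rs hmem hreg i (hlen ▸ hi)
  change Module.support A L ⊆ _
  rw [Module.support_eq_zeroLocus, PrimeSpectrum.zeroLocus_subset_zeroLocus_iff]
  exact hL

variable {K F M N P : Type} [AddCommGroup K] [Module A K] [AddCommGroup F] [Module A F]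
  [AddCommGroup M] [Module A M] [AddCommGroup N] [Module A N] [AddCommGroup P] [Module A P]

omit [IsNoetherianRing A] [IsLocalRing A] in
lemma ExtVanishes.free_tensor [Nontrivial A] [Module.Free A F] [Module.Finite A F] {n : ℕ}
    (h : ExtVanishes A n P M) : ExtVanishes A n (F ⊗[A] P) M := by
  let b := Module.finBasis A F
  exact (h.pi_left _).congr
    ((TensorProduct.comm A _ _ ≪≫ₗ TensorProduct.piScalarRight A A P _).symm ≪≫ₗ
      TensorProduct.congr b.equivFun.symm (.refl A P)) (.refl A M)

omit [IsNoetherianRing A] [IsLocalRing A] in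
lemma ExtVanishes.range_of_ker {f : K →ₗ[A] F} {n : ℕ} (hker : ExtVanishes A n (LinearMap.ker f) M)
    (hK : ExtVanishes A (n + 1) K M) : ExtVanishes A (n + 1) (LinearMap.range f) M :=
  hker.contra_right (f := (LinearMap.ker f).subtype) (g := f.rangeRestrict)
    (LinearMap.ker f).injective_subtype (fun x ↦ by simp [Subtype.ext_iff])
    f.surjective_rangeRestrict hK

omit [IsNoetherianRing A] [IsLocalRing A] in
lemma ExtVanishes.contra_right_of_exact {f : K →ₗ[A] F} {g : F →ₗ[A] N} {n : ℕ}
    (hfg : Function.Exact f g) (hg : Function.Surjective g)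
    (hker : ExtVanishes A n (LinearMap.ker f) M) (hK : ExtVanishes A (n + 1) K M)
    (hF : ExtVanishes A (n + 2) F M) : ExtVanishes A (n + 2) N M :=
  (hker.range_of_ker hK).contra_right (f := (LinearMap.range f).subtype) (g := g)
    (LinearMap.range f).injective_subtype
    (by rwa [LinearMap.exact_iff, Submodule.range_subtype, ← LinearMap.exact_iff]) hg hF

lemma extVanishes_tensor_of_syzygy {t n : ℕ}
    (hk : ∀ i < t, ExtVanishes A i (A ⧸ maximalIdeal A) A) (hn : n < t)
    [Module.Finite A K] [Module.Finite A P] [Module.Free A F] [Module.Finite A F]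
    {f : K →ₗ[A] F} {g : F →ₗ[A] N} (hf : Function.Injective f) (hfg : Function.Exact f g)
    (hg : Function.Surjective g) (hN : maximalIdeal A ≤ (freeFactorIdeal A N).radical)
    (hK : ExtVanishes A (n + 1) (K ⊗[A] P) A) (hP : ExtVanishes A (n + 2) P A) :
    ExtVanishes A (n + 2) (N ⊗[A] P) A := by
  have hle := freeFactorIdeal_le_annihilator_ker_rTensor (P := P) hf hfg hg
  exact ExtVanishes.contra_right_of_exact (rTensor_exact P hfg hg)
    (LinearMap.rTensor_surjective P hg)
    (extVanishes_of_torsion hk (hN.trans (Ideal.radical_mono hle)) hn) hK hP.free_tensor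

lemma extVanishes_tensor {t : ℕ} (hk : ∀ i < t, ExtVanishes A i (A ⧸ maximalIdeal A) A)
    [Module.Finite A N] [Module.Finite A P] {n : ℕ} (hn : n + 1 < t)
    (hP : ∀ q ≤ n, ExtVanishes A (q + 1) P A)
    (hNP : ExtVanishes A (n + 1) N (Module.Dual A P))
    (hN : maximalIdeal A ≤ (freeFactorIdeal A N).radical) :
    ExtVanishes A (n + 1) (N ⊗[A] P) A := by
  induction n generalizing N with
  | zero =>
    obtain ⟨m, g, hg⟩ := Module.Finite.exists_fin' A N
    have hex := LinearMap.exact_subtype_ker_map g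
    have hinj := (LinearMap.ker g).injective_subtype
    have hex' := rTensor_exact P hex hg
    set ι := (LinearMap.ker g).subtype.rTensor P
    have hexι : Function.Exact (LinearMap.range ι).subtype (g.rTensor P) := by
      rwa [LinearMap.exact_iff, Submodule.range_subtype, ← LinearMap.exact_iff]
    refine extVanishes_one_of_extend (A := LinearMap.range ι)
      (LinearMap.range ι).injective_subtype hexι
      (LinearMap.rTensor_surjective P hg) (hP 0 le_rfl).free_tensor fun u ↦ ?_
    obtain ⟨v, hv⟩ := hNP.exists_extend hinj hex hg
      (TensorProduct.curry (u ∘ₗ ι.rangeRestrict))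
    refine ⟨TensorProduct.lift v, ?_⟩
    have hcomp : TensorProduct.lift v ∘ₗ ι = u ∘ₗ ι.rangeRestrict :=
      TensorProduct.ext' fun x y ↦ congrArg (fun φ ↦ φ x y) hv
    ext ⟨_, x, rfl⟩
    exact LinearMap.congr_fun hcomp x
  | succ n ih =>
    obtain ⟨m, g, hg⟩ := Module.Finite.exists_fin' A N
    have hex := LinearMap.exact_subtype_ker_map g
    have hinj := (LinearMap.ker g).injective_subtype
    have hle := freeFactorIdeal_le_of_exact hinj hex hg
    rw [← ExtVanishes.left_succ_iff hinj hex hg] at hNP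
    have hK := ih (N := LinearMap.ker g) (by lia) (fun q hq ↦ hP q (by lia)) hNP
      (hN.trans (Ideal.radical_mono hle))
    exact extVanishes_tensor_of_syzygy hk (by lia) hinj hex hg hN hK (hP _ le_rfl)

end DepthVanishing

section SyzygyDual

variable {A : Type} [CommRing A] {K F M : Type} [AddCommGroup K] [Module A K] [AddCommGroup F]
  [Module A F] [AddCommGroup M] [Module A M]
variable {f : K →ₗ[A] F} {g : F →ₗ[A] M} (hf : Function.Injective f) (hfg : Function.Exact f g)
  (hg : Function.Surjective g) [Module.Free A F] [Module.Finite A F]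

include hf in
lemma Module.Dual.eval_injective_of_injective : Function.Injective (Module.Dual.eval A K) := by
  refine (injective_iff_map_eq_zero _).2 fun x hx ↦ hf ?_
  rw [map_zero]
  refine (Module.evalEquiv A F).injective ?_
  ext φ
  simpa using congrArg (fun χ ↦ χ (φ ∘ₗ f)) hx

include hf hfg hg

lemma ExtVanishes.syzygy_self [Nontrivial A] {n : ℕ} (h1 : ExtVanishes A (n + 2) M A)
    (h2 : ExtVanishes A (n + 1) M M) : ExtVanishes A (n + 1) K K := by
  rw [ExtVanishes.left_succ_iff hf hfg hg]
  refine h2.cov_left hf hfg hg ?_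
  exact (h1.pi_right _).congr (.refl A M) (Module.finBasis A F).equivFun.symm

lemma isReflexive_of_syzygy (h1 : ExtVanishes A 1 M A)
    (hM : Function.Injective (Module.Dual.eval A M)) : Module.IsReflexive A K := by
  refine ⟨Module.Dual.eval_injective_of_injective hf, fun χ ↦ ?_⟩
  obtain ⟨y, hy⟩ := (Module.evalEquiv A F).surjective (χ ∘ₗ f.dualMap)
  have hy' : ∀ φ : Module.Dual A F, φ y = χ (φ ∘ₗ f) := fun φ ↦ by
    exact congrArg (fun ψ ↦ ψ φ) hy
  have hgy : g y = 0 := hM <| by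
    ext φ
    have := hy' (φ ∘ₗ g)
    rw [LinearMap.comp_assoc, hfg.linearMap_comp_eq_zero, LinearMap.comp_zero, map_zero] at this
    simpa using this
  obtain ⟨x, rfl⟩ := (hfg y).1 hgy
  refine ⟨x, LinearMap.ext fun φ ↦ ?_⟩
  obtain ⟨ψ, rfl⟩ := h1.exists_extend hf hfg hg φ
  simpa using hy' ψ

omit [Module.Free A F] [Module.Finite A F] in
lemma dualMap_exact_of_extVanishes (h1 : ExtVanishes A 1 M A) :
    Function.Injective g.dualMap ∧ Function.Exact g.dualMap f.dualMap ∧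
      Function.Surjective f.dualMap := by
  refine ⟨LinearMap.dualMap_injective_of_surjective hg, fun φ ↦ ?_, fun φ ↦ ?_⟩
  · rw [← LinearMap.mem_ker, ← LinearMap.coe_range, SetLike.mem_coe,
      LinearMap.range_dualMap_eq_dualAnnihilator_ker_of_surjective g hg,
      LinearMap.ker_dualMap_eq_dualAnnihilator_range, hfg.linearMap_ker_eq]
  · obtain ⟨v, hv⟩ := h1.exists_extend hf hfg hg φ
    exact ⟨v, hv⟩

lemma ExtVanishes.dual_syzygy_one (h1 : ExtVanishes A 1 M A) [Module.IsReflexive A M] :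
    ExtVanishes A 1 (Module.Dual A K) A := by
  obtain ⟨h₁, h₂, h₃⟩ := dualMap_exact_of_extVanishes hf hfg hg h1
  refine extVanishes_one_of_extend h₁ h₂ h₃ (extVanishes_of_projective 0) fun u ↦ ?_
  obtain ⟨m, rfl⟩ := (Module.evalEquiv A M).surjective u
  obtain ⟨y, rfl⟩ := hg m
  exact ⟨Module.Dual.eval A F y, by ext; simp⟩

lemma ExtVanishes.dual_syzygy_succ (h1 : ExtVanishes A 1 M A) {q : ℕ}
    (hq : ExtVanishes A (q + 1) (Module.Dual A M) A) :
    ExtVanishes A (q + 2) (Module.Dual A K) A := by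
  obtain ⟨h₁, h₂, h₃⟩ := dualMap_exact_of_extVanishes hf hfg hg h1
  exact (ExtVanishes.left_succ_iff h₁ h₂ h₃).1 hq

omit [Module.Finite A F] in
lemma projective_of_projective_syzygy [Module.Projective A K] [Module.Finite A K]
    (h1 : ExtVanishes A 1 M A) : Module.Projective A M := by
  obtain ⟨-, -, h₃⟩ := dualMap_exact_of_extVanishes hf hfg hg h1
  obtain ⟨x, hx⟩ := id_mem_range_dualTensorHom_of_projective (A := A) (M := K)
  obtain ⟨y, rfl⟩ := LinearMap.rTensor_surjective K h₃ x
  have hr : dualTensorHom A F K y ∘ₗ f = LinearMap.id := by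
    rw [← hx]
    clear hx
    induction y with
    | zero => simp
    | add x y hx hy => simp only [map_add, LinearMap.add_comp, hx, hy]
    | tmul φ m => ext; simp
  obtain ⟨s, hs⟩ : ∃ s, g ∘ₗ s = LinearMap.id :=
    ((hfg.split_tfae hf hg).out 0 1).2 (show ∃ l, l ∘ₗ f = LinearMap.id from ⟨_, hr⟩)
  exact Module.Projective.of_split s g hs

end SyzygyDual

section SelfDualVanishing

lemma ExtVanishes.contra_right_of_factor {A B C W X Y : Type} [CommRing A] [AddCommGroup B]
    [Module A B] [AddCommGroup C] [Module A C] [AddCommGroup W] [Module A W] [AddCommGroup X]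
    [Module A X] [AddCommGroup Y] [Module A Y] {f : X →ₗ[A] B} {j : B →ₗ[A] W} {l : W →ₗ[A] C}
    (hf : Function.Injective f) (hfg : Function.Exact f (l ∘ₗ j))
    (hg : Function.Surjective (l ∘ₗ j)) {n : ℕ} (hX : ExtVanishes A n X Y)
    (hW : ExtVanishes A (n + 1) W Y) : ExtVanishes A (n + 1) C Y := by
  rw [extVanishes_iff] at *
  intro e
  have h0 : (Abelian.Ext.mk₀ (ModuleCat.ofHom (l ∘ₗ j))).comp e (zero_add _) = 0 := by
    rw [ModuleCat.ofHom_comp, ← Abelian.Ext.mk₀_comp_mk₀,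
      Abelian.Ext.comp_assoc_of_second_deg_zero,
      hW ((Abelian.Ext.mk₀ (ModuleCat.ofHom l)).comp e (zero_add _)), Abelian.Ext.comp_zero]
  obtain ⟨x, rfl⟩ := Abelian.Ext.contravariant_sequence_exact₃
    (shortExact_of_linearMap hf hfg hg) _ e h0 (add_comm 1 n)
  rw [hX x, Abelian.Ext.comp_zero]

variable {A : Type} [CommRing A] [IsLocalRing A]

lemma exists_linearMap_residue_apply_eq_one {W : Type} [AddCommGroup W] [Module A W]
    {V : Submodule A W} (hV : maximalIdeal A • (⊤ : Submodule A W) ≤ V) {w : W} (hw : w ∉ V) :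
    ∃ l : W →ₗ[A] A ⧸ maximalIdeal A, V ≤ LinearMap.ker l ∧ l w = 1 := by
  have htors : Module.IsTorsionBySet A (W ⧸ V) (maximalIdeal A) := by
    rintro x ⟨a, ha⟩
    obtain ⟨x, rfl⟩ := V.mkQ_surjective x
    rw [← map_smul, Submodule.mkQ_apply, Submodule.Quotient.mk_eq_zero]
    exact hV (Submodule.smul_mem_smul ha trivial)
  let := htors.module
  let : Field (A ⧸ maximalIdeal A) := Ideal.Quotient.field _
  have hne : V.mkQ w ≠ 0 := by rwa [Submodule.mkQ_apply, Ne, Submodule.Quotient.mk_eq_zero]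
  obtain ⟨φ, hφ⟩ : ∃ φ : Module.Dual (A ⧸ maximalIdeal A) (W ⧸ V), φ (V.mkQ w) ≠ 0 := by
    by_contra! h
    exact hne ((Module.forall_dual_apply_eq_zero_iff _ _).1 h)
  have hst := htors.isScalarTower (S := A)
  refine ⟨(((φ (V.mkQ w))⁻¹ • φ).restrictScalars A) ∘ₗ V.mkQ, fun v hv ↦ ?_, ?_⟩
  · have : V.mkQ v = 0 := by simpa using hv
    rw [LinearMap.mem_ker, LinearMap.comp_apply, this, map_zero]
  · exact inv_mul_cancel₀ hφ

variable [IsNoetherianRing A] {N : Type} [AddCommGroup N] [Module A N] [Module.Finite A N]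

omit [IsNoetherianRing A] in
lemma projective_of_id_sub_mem {β : N →ₗ[A] N}
    (hβ : β ∈ LinearMap.range (dualTensorHom A N N))
    (h : ∀ x, x - β x ∈ maximalIdeal A • (⊤ : Submodule A N)) : Module.Projective A N := by
  have hsurj : Function.Surjective β := by
    rw [← LinearMap.range_eq_top, ← top_le_iff]
    refine Submodule.le_of_le_smul_of_le_jacobson_bot Module.Finite.fg_top
      (IsLocalRing.maximalIdeal_le_jacobson ⊥) fun x _ ↦ ?_
    rw [← sub_add_cancel x (β x), add_comm]
    exact Submodule.add_mem_sup (LinearMap.mem_range_self β x) (h x)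
  let e := LinearEquiv.ofBijective β (OrzechProperty.bijective_of_surjective_endomorphism β hsurj)
  refine projective_of_id_mem_range_dualTensorHom (M := N) ?_
  have : e.symm.toLinearMap ∘ₗ β = LinearMap.id := LinearMap.ext fun x ↦ e.symm_apply_apply x
  rw [← this]
  exact comp_mem_range_dualTensorHom_left _ hβ

lemma projective_of_isReflexive {s : ℕ}
    (hk : ∀ i < s + 2, ExtVanishes A i (A ⧸ maximalIdeal A) A)
    (hk' : ¬ ExtVanishes A (s + 2) (A ⧸ maximalIdeal A) A) [Module.IsReflexive A N]
    (hdual : ∀ q ≤ s, ExtVanishes A (q + 1) (Module.Dual A N) A)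
    (hN : ExtVanishes A (s + 2) N A) (hNN : ExtVanishes A (s + 1) N N)
    (hI : maximalIdeal A ≤ (freeFactorIdeal A N).radical) : Module.Projective A N := by
  obtain ⟨n, π, hπ⟩ := Module.Finite.exists_fin' A N
  let x : Fin n → N := fun i ↦ π (Pi.single i 1)
  let j : (N →ₗ[A] N) →ₗ[A] (Fin n → N) := LinearMap.pi fun i ↦ LinearMap.applyₗ (x i)
  have hj_mem : ∀ φ : N →ₗ[A] N, ∀ S : Submodule A N, (∀ i, φ (x i) ∈ S) → ∀ y, φ y ∈ S := by
    intro φ S h y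
    obtain ⟨c, rfl⟩ := hπ y
    have hle : (⊤ : Submodule A (Fin n → A)) ≤ S.comap (φ ∘ₗ π) := by
      rw [← (Pi.basisFun A (Fin n)).span_eq, Submodule.span_le]
      rintro _ ⟨i, rfl⟩
      simpa using h i
    exact hle (Submodule.mem_top (x := c))
  set B := LinearMap.range (dualTensorHom A N N) with hB
  by_cases hid : j LinearMap.id ∈ B.map j ⊔ maximalIdeal A • ⊤
  · obtain ⟨_, ⟨β, hβ, rfl⟩, v, hv, hsum⟩ := Submodule.mem_sup.1 hid
    refine projective_of_id_sub_mem hβ (hj_mem (LinearMap.id - β) _ fun i ↦ ?_)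
    have hvi : (LinearMap.id - β : N →ₗ[A] N) (x i) = v i :=
      sub_eq_of_eq_add' (congrFun hsum i).symm
    rw [hvi]
    refine Submodule.smul_induction_on hv (fun a ha w _ ↦ Submodule.smul_mem_smul ha trivial)
      fun u w hu hw ↦ add_mem hu hw
  · exfalso
    obtain ⟨l, hlV, hl1⟩ := exists_linearMap_residue_apply_eq_one le_sup_right hid
    have hBle : B ≤ LinearMap.ker (l ∘ₗ j) := fun φ hφ ↦
      hlV (Submodule.mem_sup_left (Submodule.mem_map_of_mem hφ))
    let B' := LinearMap.ker (l ∘ₗ j)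
    let h : N ⊗[A] Module.Dual A N →ₗ[A] B' :=
      (dualTensorHom A N N ∘ₗ (TensorProduct.comm A N (Module.Dual A N)).toLinearMap).codRestrict B'
        fun z ↦ hBle ⟨_, rfl⟩
    have hsurj : Function.Surjective (l ∘ₗ j) := fun c ↦ by
      obtain ⟨a, rfl⟩ := Ideal.Quotient.mk_surjective c
      refine ⟨a • LinearMap.id, ?_⟩
      rw [map_smul, LinearMap.comp_apply, hl1, Algebra.smul_def, mul_one]
      rfl
    have hT : ExtVanishes A (s + 1) (N ⊗[A] Module.Dual A N) A :=
      extVanishes_tensor hk (by lia) hdual (hNN.congr (.refl A N) (Module.evalEquiv A N)) hI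
    have hker : freeFactorIdeal A N ≤ Module.annihilator A (LinearMap.ker h) := fun r hr ↦ by
      rw [Module.mem_annihilator]
      rintro ⟨z, hz⟩
      have hz' : dualTensorHom A N N (TensorProduct.comm A N (Module.Dual A N) z) = 0 :=
        congrArg Subtype.val (LinearMap.mem_ker.1 hz)
      have := smul_eq_zero_of_dualTensorHom_eq_zero hr hz'
      rw [← map_smul, LinearEquiv.map_eq_zero_iff] at this
      exact Subtype.ext this
    have hcoker : freeFactorIdeal A N ≤ Module.annihilator A (B' ⧸ LinearMap.range h) :=
      fun r hr ↦ by
        rw [Module.mem_annihilator]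
        intro y
        obtain ⟨⟨φ, hφ⟩, rfl⟩ := Submodule.mkQ_surjective _ y
        rw [← map_smul, Submodule.mkQ_apply, Submodule.Quotient.mk_eq_zero]
        obtain ⟨z, hz⟩ := comp_mem_range_dualTensorHom_left φ (mem_freeFactorIdeal.1 hr)
        refine ⟨(TensorProduct.comm A N (Module.Dual A N)).symm z, Subtype.ext ?_⟩
        have : φ ∘ₗ (r • LinearMap.id) = r • φ := by ext; simp
        simp [h, hz, this]
    have hfin : Module.Finite A (N →ₗ[A] N) := inferInstance
    have hB' : ExtVanishes A (s + 1) B' A :=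
      (ExtVanishes.range_of_ker (extVanishes_of_torsion hk
        (hI.trans (Ideal.radical_mono hker)) (by lia)) hT).contra_mid
        (A := LinearMap.range h) (LinearMap.range h).injective_subtype
        (LinearMap.exact_subtype_mkQ _) (Submodule.mkQ_surjective _)
        (extVanishes_of_torsion hk (hI.trans (Ideal.radical_mono hcoker)) (by lia))
    exact hk' (hB'.contra_right_of_factor B'.injective_subtype
      (LinearMap.exact_subtype_ker_map _) hsurj (hN.pi_left n))

lemma projective_of_reflexive_syzygy {s n : ℕ}
    (hk : ∀ i < s + 2, ExtVanishes A i (A ⧸ maximalIdeal A) A)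
    (hk' : ¬ ExtVanishes A (s + 2) (A ⧸ maximalIdeal A) A) [Module.IsReflexive A N]
    (hn : n ≤ s + 1) (hdual : ∀ q < s + 1 - n, ExtVanishes A (q + 1) (Module.Dual A N) A)
    (hN : ∀ i < s + 2 + n, ExtVanishes A (i + 1) N A) (hNN : ExtVanishes A (s + 1) N N)
    (hI : maximalIdeal A ≤ (freeFactorIdeal A N).radical) : Module.Projective A N := by
  induction n generalizing N with
  | zero =>
    exact projective_of_isReflexive hk hk' (fun q hq ↦ hdual q (by lia)) (hN (s + 1) (by lia)) hNN
      hI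
  | succ n ih =>
    obtain ⟨m, g, hg⟩ := Module.Finite.exists_fin' A N
    have hex := LinearMap.exact_subtype_ker_map g
    have hinj := (LinearMap.ker g).injective_subtype
    have h1 := hN 0 (by lia)
    have hrefl : Module.IsReflexive A (LinearMap.ker g) := isReflexive_of_syzygy hinj hex hg h1
      (Module.bijective_dual_eval A N).injective
    have : Module.Projective A (LinearMap.ker g) := by
      refine ih (by lia) (fun q hq ↦ ?_) (fun i hi ↦ ?_)
        (ExtVanishes.syzygy_self hinj hex hg (hN _ (by lia)) hNN)
        (hI.trans (Ideal.radical_mono (freeFactorIdeal_le_of_exact hinj hex hg)))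
      · cases q with
        | zero => exact ExtVanishes.dual_syzygy_one hinj hex hg h1
        | succ q => exact ExtVanishes.dual_syzygy_succ hinj hex hg h1 (hdual q (by lia))
      · exact (ExtVanishes.left_succ_iff hinj hex hg).2 (hN (i + 1) (by lia))
    exact projective_of_projective_syzygy hinj hex hg h1

/-- Over a local ring of depth at least two, a finitely generated module which is locally free
on the punctured spectrum, with enough vanishing of Ext, is projective. -/
theorem projective_of_extVanishes_of_two_le_depth {t : ℕ} (ht : 2 ≤ t)
    (hk : ∀ i < t, ExtVanishes A i (A ⧸ maximalIdeal A) A)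
    (hk' : ¬ ExtVanishes A t (A ⧸ maximalIdeal A) A)
    (hN : ∀ i < 2 * t + 1, ExtVanishes A (i + 1) N A) (hNN : ExtVanishes A (t - 1) N N)
    (hI : maximalIdeal A ≤ (freeFactorIdeal A N).radical) : Module.Projective A N := by
  obtain ⟨s, rfl⟩ := Nat.exists_eq_add_of_le' ht
  obtain ⟨m, g, hg⟩ := Module.Finite.exists_fin' A N
  have hex := LinearMap.exact_subtype_ker_map g
  have hinj := (LinearMap.ker g).injective_subtype
  obtain ⟨m', g', hg'⟩ := Module.Finite.exists_fin' A (LinearMap.ker g)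
  have hex' := LinearMap.exact_subtype_ker_map g'
  have hinj' := (LinearMap.ker g').injective_subtype
  have hK : ∀ i < 2 * s + 4, ExtVanishes A (i + 1) (LinearMap.ker g) A := fun i hi ↦
    (ExtVanishes.left_succ_iff hinj hex hg).2 (hN (i + 1) (by lia))
  have hKK := ExtVanishes.syzygy_self hinj hex hg (hN _ (by lia)) hNN
  have hIK := hI.trans (Ideal.radical_mono (freeFactorIdeal_le_of_exact hinj hex hg))
  have hrefl : Module.IsReflexive A (LinearMap.ker g') := isReflexive_of_syzygy hinj' hex' hg'
    (hK 0 (by lia)) (Module.Dual.eval_injective_of_injective hinj)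
  have : Module.Projective A (LinearMap.ker g') :=
    projective_of_reflexive_syzygy (n := s + 1) hk hk' le_rfl (fun q hq ↦ by lia)
      (fun i hi ↦ (ExtVanishes.left_succ_iff hinj' hex' hg').2 (hK (i + 1) (by lia)))
      (ExtVanishes.syzygy_self hinj' hex' hg' (hK _ (by lia)) hKK)
      (hIK.trans (Ideal.radical_mono (freeFactorIdeal_le_of_exact hinj' hex' hg')))
  have : Module.Projective A (LinearMap.ker g) :=
    projective_of_projective_syzygy hinj' hex' hg' (hK 0 (by lia))
  exact projective_of_projective_syzygy hinj hex hg (hN 0 (by lia))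

end SelfDualVanishing

section ProjectiveDimension

/-- The projective dimension of `M` is at most `n`. -/
def ProjDimLE (R : Type) [CommRing R] (n : ℕ) (M : Type) [AddCommGroup M] [Module R M] : Prop :=
  HasProjectiveDimensionLT (ModuleCat.of R M) (n + 1)

variable {R : Type} [CommRing R] {K F M : Type} [AddCommGroup K] [Module R K] [AddCommGroup F]
  [Module R F] [AddCommGroup M] [Module R M]

lemma projDimLE_zero_iff : ProjDimLE R 0 M ↔ Module.Projective R M := by
  rw [ProjDimLE, zero_add, ← projective_iff_hasProjectiveDimensionLT_one,
    ← IsProjective.iff_projective]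

lemma ProjDimLE.mono {m n : ℕ} (h : ProjDimLE R m M) (hmn : m ≤ n) : ProjDimLE R n M :=
  have : HasProjectiveDimensionLT (ModuleCat.of R M) (m + 1) := h
  hasProjectiveDimensionLT_of_ge _ (m + 1) _ (by lia)

lemma ProjDimLE.retract {n : ℕ} (h : ProjDimLE R n M) (i : K →ₗ[R] M) (r : M →ₗ[R] K)
    (hri : r ∘ₗ i = LinearMap.id) : ProjDimLE R n K :=
  have : HasProjectiveDimensionLT (ModuleCat.of R M) (n + 1) := h
  (Retract.mk (ModuleCat.ofHom i) (ModuleCat.ofHom r)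
    (by ext x; exact LinearMap.congr_fun hri x)).hasProjectiveDimensionLT (n + 1)

lemma projDimLE_succ_iff {f : K →ₗ[R] F} {g : F →ₗ[R] M} (hf : Function.Injective f)
    (hfg : Function.Exact f g) (hg : Function.Surjective g) [Module.Projective R F] {n : ℕ} :
    ProjDimLE R (n + 1) M ↔ ProjDimLE R n K :=
  (shortExact_of_linearMap hf hfg hg).hasProjectiveDimensionLT_X₃_iff n
    ((IsProjective.iff_projective F).1 ‹_›)

section QuotSMulTop

variable {x : R} {f : K →ₗ[R] F} {g : F →ₗ[R] M}

/-- The map of `R ⧸ (x)`-modules induced modulo `x` by an `R`-linear map. -/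
def quotSMulTopMap (x : R) (f : K →ₗ[R] F) :
    QuotSMulTop x K →ₗ[R ⧸ Ideal.span {x}] QuotSMulTop x F :=
  (QuotSMulTop.map x f).extendScalarsOfSurjective Ideal.Quotient.mk_surjective

lemma quotSMulTopMap_injective (hf : Function.Injective f) (hfg : Function.Exact f g)
    (hx : IsSMulRegular M x) : Function.Injective (quotSMulTopMap x f) := by
  have h0 : Function.Exact (0 : PUnit.{1} →ₗ[R] K) f := fun y ↦
    ⟨fun hy ↦ ⟨0, (hf (hy.trans (map_zero f).symm)).symm⟩, by rintro ⟨_, rfl⟩; simp⟩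
  have h := QuotSMulTop.map_first_exact_on_four_term_exact_of_isSMulRegular_last h0 hfg hx
  refine (injective_iff_map_eq_zero _).2 fun y hy ↦ ?_
  obtain ⟨z, rfl⟩ := (h y).1 hy
  rw [map_zero, LinearMap.zero_apply]

lemma projDimLE_quotSMulTop_iff [IsNoetherianRing R] [IsLocalRing R]
    (hx : x ∈ maximalIdeal R) (hxR : IsSMulRegular R x) [Module.Finite R M]
    (hxM : IsSMulRegular M x) {n : ℕ} :
    ProjDimLE (R ⧸ Ideal.span {x}) n (QuotSMulTop x M) ↔ ProjDimLE R n M := by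
  have hle : Ideal.span {x} ≤ maximalIdeal R := by rwa [Ideal.span_singleton_le_iff_mem]
  have : Nontrivial (R ⧸ Ideal.span {x}) := Ideal.Quotient.nontrivial_iff.2
    (hle.trans_lt (Ideal.IsMaximal.ne_top inferInstance).lt_top).ne
  have : IsLocalRing (R ⧸ Ideal.span {x}) :=
    IsLocalRing.of_surjective' _ Ideal.Quotient.mk_surjective
  induction n generalizing M with
  | zero =>
    have := Module.Finite.of_restrictScalars_finite R (R ⧸ Ideal.span {x}) (QuotSMulTop x M)
    have hMfp : Module.FinitePresentation R M := Module.finitePresentation_of_finite R M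
    have h := Module.free_quotSMulTop_iff_free R M (IsLocalRing.maximalIdeal_le_jacobson ⊥ hx) hxM
    rw [projDimLE_zero_iff, projDimLE_zero_iff]
    exact ⟨fun _ ↦ have := h.1 Module.free_of_flat_of_isLocalRing; inferInstance,
      fun _ ↦ have := h.2 Module.free_of_flat_of_isLocalRing; inferInstance⟩
  | succ n ih =>
    obtain ⟨m, g, hg⟩ := Module.Finite.exists_fin' R M
    have hex := LinearMap.exact_subtype_ker_map g
    have hinj := (LinearMap.ker g).injective_subtype
    have hxF : IsSMulRegular (Fin m → R) x := IsSMulRegular.pi fun _ ↦ hxR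
    exact (projDimLE_succ_iff (f := quotSMulTopMap x (LinearMap.ker g).subtype)
      (g := quotSMulTopMap x g) (quotSMulTopMap_injective hinj hex hxM)
      (QuotSMulTop.map_exact x hex hg) (QuotSMulTop.map_surjective x hg)).trans
      ((ih (hxF.of_injective _ hinj)).trans (projDimLE_succ_iff hinj hex hg).symm)

end QuotSMulTop

end ProjectiveDimension

section RegularLocalRing

variable {S : Type} [CommRing S] [IsNoetherianRing S] [IsLocalRing S]

lemma exists_mem_maximalIdeal_notMem (h : 0 < ringKrullDim S) :
    ∃ x ∈ maximalIdeal S, x ∉ maximalIdeal S ^ 2 ∧ ∀ p ∈ minimalPrimes S, x ∉ p := by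
  classical
  have hmin : ∀ p ∈ minimalPrimes S, ¬ maximalIdeal S ≤ p := fun p hp hle ↦ by
    have hpp : p.IsPrime := hp.1.1
    obtain rfl : maximalIdeal S = p := le_antisymm hle (IsLocalRing.le_maximalIdeal hpp.ne_top)
    rw [← IsLocalRing.maximalIdeal_height_eq_ringKrullDim, Ideal.height_eq_zero_iff.2 hp] at h
    simp at h
  have hsq : ¬ maximalIdeal S ≤ maximalIdeal S ^ 2 := fun hle ↦ by
    have hbot : maximalIdeal S = ⊥ := by
      refine Submodule.eq_bot_of_le_smul_of_le_jacobson_bot (maximalIdeal S) _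
        (IsNoetherian.noetherian _) ?_ (IsLocalRing.maximalIdeal_le_jacobson ⊥)
      rwa [smul_eq_mul, ← sq]
    obtain ⟨p, hp, -⟩ := Ideal.exists_minimalPrimes_le (I := (⊥ : Ideal S)) (J := maximalIdeal S)
      bot_le
    exact hmin p hp (hbot ▸ bot_le)
  have hfin := minimalPrimes.finite_of_isNoetherianRing S
  have key := (Ideal.subset_union_prime (s := insert (maximalIdeal S ^ 2) hfin.toFinset) (f := id)
    (maximalIdeal S ^ 2) (maximalIdeal S ^ 2) (fun i hi h _ ↦ by
      have hi' : i ∈ minimalPrimes S := by simpa [h] using hi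
      exact hi'.1.1) (I := maximalIdeal S)).1
  by_contra! H
  obtain ⟨p, hp, hle⟩ := key fun x hx ↦ by
    by_cases hx2 : x ∈ maximalIdeal S ^ 2
    · exact Set.mem_iUnion₂.2 ⟨maximalIdeal S ^ 2, by simp, hx2⟩
    · obtain ⟨p, hp, hxp⟩ := H x hx hx2
      exact Set.mem_iUnion₂.2 ⟨p, by simp [hp], hxp⟩
  rw [Finset.mem_insert, Set.Finite.mem_toFinset] at hp
  obtain rfl | hp := hp
  · exact hsq hle
  · exact hmin p hp hle

omit [IsNoetherianRing S] in
lemma exists_span_eq_maximalIdeal_quotient [DecidableEq S] {s : Finset S}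
    (hs : Ideal.span (s : Set S) = maximalIdeal S) {x : S} (hx : x ∈ maximalIdeal S)
    (hx2 : x ∉ maximalIdeal S ^ 2) :
    ∃ y ∈ s, Ideal.span (insert x ((s.erase y : Finset S) : Set S)) = maximalIdeal S := by
  obtain ⟨c, hc⟩ : ∃ c : S → S, ∑ a ∈ s, c a * a = x := by
    rw [← hs] at hx
    obtain ⟨c, -, hc⟩ := Submodule.mem_span_finset.1 hx
    exact ⟨c, hc⟩
  have hmem : ∀ a ∈ s, a ∈ maximalIdeal S := fun a ha ↦ hs ▸ Ideal.subset_span ha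
  obtain ⟨y, hy, hcy⟩ : ∃ y ∈ s, IsUnit (c y) := by
    by_contra! H
    refine hx2 (hc ▸ Ideal.sum_mem _ fun a ha ↦ ?_)
    rw [sq]
    exact Ideal.mul_mem_mul ((IsLocalRing.mem_maximalIdeal _).2 (H a ha)) (hmem a ha)
  refine ⟨y, hy, le_antisymm (Ideal.span_le.2 ?_) ?_⟩
  · rintro a (rfl | ha)
    · exact hx
    · exact hmem a (Finset.mem_of_mem_erase ha)
  · rw [← hs, Ideal.span_le]
    intro a ha
    by_cases hay : a = y
    · subst hay
      rw [SetLike.mem_coe, ← Ideal.unit_mul_mem_iff_mem _ hcy]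
      rw [← Finset.add_sum_erase _ _ hy] at hc
      rw [← eq_sub_iff_add_eq] at hc
      rw [hc]
      exact sub_mem (Ideal.subset_span (Set.mem_insert _ _)) (Ideal.sum_mem _ fun b hb ↦
        Ideal.mul_mem_left _ _ (Ideal.subset_span (Set.mem_insert_of_mem _ hb)))
    · exact Ideal.subset_span (Set.mem_insert_of_mem _ (Finset.mem_erase.2 ⟨hay, ha⟩))

lemma isDomain_of_isPrime_span_singleton {x : S} (hx : (Ideal.span {x}).IsPrime)
    (hxm : x ∈ maximalIdeal S) (hmin : ∀ p ∈ minimalPrimes S, x ∉ p) : IsDomain S := by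
  obtain ⟨p, hp, hle⟩ := Ideal.exists_minimalPrimes_le (I := (⊥ : Ideal S))
    (J := Ideal.span {x}) bot_le
  have hpp : p.IsPrime := hp.1.1
  have hbot : p = ⊥ := by
    refine Submodule.eq_bot_of_le_smul_of_le_jacobson_bot (maximalIdeal S) _
      (IsNoetherian.noetherian _) (fun y hy ↦ ?_) (IsLocalRing.maximalIdeal_le_jacobson ⊥)
    obtain ⟨z, rfl⟩ := Ideal.mem_span_singleton'.1 (hle hy)
    rw [mul_comm]
    exact Submodule.smul_mem_smul hxm ((hpp.mem_or_mem hy).resolve_right (hmin p hp))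
  subst hbot
  exact (IsDomain.of_bot_isPrime S)

theorem isDomain_and_exists_projDimLE (n : ℕ) : ∀ (S : Type) [CommRing S] [IsNoetherianRing S]
    [IsLocalRing S] (s : Finset S), Ideal.span (s : Set S) = maximalIdeal S → s.card ≤ n →
    (n : WithBot ℕ∞) ≤ ringKrullDim S → IsDomain S ∧
      ∀ (M : Type) [AddCommGroup M] [Module S M] [Module.Finite S M], ∃ k, ProjDimLE S k M := by
  classical
  induction n with
  | zero =>
    intro S _ _ _ s hs hcard hdim
    have hfield : IsField S := by
      rw [IsLocalRing.isField_iff_maximalIdeal_eq, ← hs,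
        (Finset.card_eq_zero (s := s)).1 (Nat.le_zero.1 hcard)]
      simp
    refine ⟨hfield.isDomain, fun M _ _ _ ↦ ⟨0, projDimLE_zero_iff.2 ?_⟩⟩
    let := hfield.toField
    exact Module.Projective.of_free (R := S) (P := M)
  | succ n ih =>
    intro S _ _ _ s hs hcard hdim
    obtain ⟨x, hx, hx2, hxmin⟩ := exists_mem_maximalIdeal_notMem (S := S)
      (lt_of_lt_of_le (by exact_mod_cast n.succ_pos) hdim)
    obtain ⟨y, hy, hspan⟩ := exists_span_eq_maximalIdeal_quotient hs hx hx2
    have hle : Ideal.span {x} ≤ maximalIdeal S := by rwa [Ideal.span_singleton_le_iff_mem]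
    have : Nontrivial (S ⧸ Ideal.span {x}) := Ideal.Quotient.nontrivial_iff.2
      (hle.trans_lt (Ideal.IsMaximal.ne_top inferInstance).lt_top).ne
    have hloc : IsLocalRing (S ⧸ Ideal.span {x}) :=
      IsLocalRing.of_surjective' _ Ideal.Quotient.mk_surjective
    have hmax : Ideal.span (((s.erase y).image (Ideal.Quotient.mk (Ideal.span {x})) : Finset _) :
        Set (S ⧸ Ideal.span {x})) = maximalIdeal (S ⧸ Ideal.span {x}) := by
      rw [← IsLocalRing.map_maximalIdeal_of_surjective (Ideal.Quotient.mk (Ideal.span {x}))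
        Ideal.Quotient.mk_surjective, ← hspan, Ideal.map_span, Set.image_insert_eq,
        Ideal.Quotient.mk_singleton_self, Ideal.span_insert_zero, Finset.coe_image]
    have hdim' : (n : WithBot ℕ∞) ≤ ringKrullDim (S ⧸ Ideal.span {x}) := by
      have h := hdim.trans_eq IsLocalRing.maximalIdeal_height_eq_ringKrullDim.symm
      have h' := h.trans (Ideal.height_le_ringKrullDim_quotient_add_one hx)
      rw [Nat.cast_succ] at h'
      exact ENat.WithBot.add_le_add_one_right_iff.1 h'
    obtain ⟨hdom, hpd⟩ := ih (S ⧸ Ideal.span {x}) _ hmax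
      (Finset.card_image_le.trans (by rw [Finset.card_erase_of_mem hy]; lia)) hdim'
    have hprime := (Ideal.Quotient.isDomain_iff_prime (Ideal.span {x})).1 hdom
    have hS := isDomain_of_isPrime_span_singleton hprime hx hxmin
    refine ⟨hS, fun M _ _ _ ↦ ?_⟩
    have hx0 : x ≠ 0 := fun h ↦ hx2 (h ▸ zero_mem _)
    have hxS : IsSMulRegular S x := (IsRegular.of_ne_zero hx0).left
    obtain ⟨m, g, hg⟩ := Module.Finite.exists_fin' S M
    have hinj := (LinearMap.ker g).injective_subtype
    have hxF : IsSMulRegular (Fin m → S) x := IsSMulRegular.pi fun _ ↦ hxS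
    have := Module.Finite.of_restrictScalars_finite S (S ⧸ Ideal.span {x})
      (QuotSMulTop x (LinearMap.ker g))
    obtain ⟨k, hk⟩ := hpd (QuotSMulTop x (LinearMap.ker g))
    exact ⟨k + 1, (projDimLE_succ_iff hinj (LinearMap.exact_subtype_ker_map g) hg).2
      ((projDimLE_quotSMulTop_iff hx hxS (hxF.of_injective _ hinj)).1 hk)⟩

end RegularLocalRing

section ChangeOfRings

section Koszul

variable {R : Type} [CommRing R] {F X : Type} [AddCommGroup F] [Module R F] [AddCommGroup X]
  [Module R X] {f : R} {g : F →ₗ[R] X}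

lemma smul_mem_ker_of_smul_eq_zero (hX : ∀ x : X, f • x = 0) (g : F →ₗ[R] X) (y : F) :
    f • y ∈ LinearMap.ker g := by
  rw [LinearMap.mem_ker, map_smul, hX]

open scoped Pointwise in
lemma exists_map_to_quotSMulTop_ker (hX : ∀ x : X, f • x = 0) (hg : Function.Surjective g) :
    ∃ a : X →ₗ[R] QuotSMulTop f (LinearMap.ker g),
      ∀ y, a (g y) = Submodule.Quotient.mk ⟨f • y, smul_mem_ker_of_smul_eq_zero hX g y⟩ := by
  let a₀ : F →ₗ[R] LinearMap.ker g :=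
    (f • LinearMap.id).codRestrict _ (smul_mem_ker_of_smul_eq_zero hX g)
  let a₁ : F →ₗ[R] QuotSMulTop f (LinearMap.ker g) := Submodule.mkQ _ ∘ₗ a₀
  have h : LinearMap.ker g ≤ LinearMap.ker a₁ := fun y hy ↦
    (Submodule.Quotient.mk_eq_zero _).2 (
      Submodule.smul_mem_pointwise_smul (⟨y, hy⟩ : LinearMap.ker g) f _ trivial)
  refine ⟨(LinearMap.ker g).liftQ a₁ h ∘ₗ (g.quotKerEquivOfSurjective hg).symm, fun y ↦ ?_⟩
  have : (g.quotKerEquivOfSurjective hg).symm (g y) = Submodule.Quotient.mk y :=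
    (LinearEquiv.symm_apply_eq _).2 rfl
  rw [LinearMap.comp_apply, LinearEquiv.coe_coe, this]
  rfl

open scoped Pointwise in
lemma retract_quotSMulTop_ker (hX : ∀ x : X, f • x = 0) (hg : Function.Surjective g)
    {r : LinearMap.ker g →ₗ[R] X}
    (hr : ∀ y, r ⟨f • y, smul_mem_ker_of_smul_eq_zero hX g y⟩ = g y) :
    ∃ (i : X →ₗ[R] QuotSMulTop f (LinearMap.ker g)) (p : QuotSMulTop f (LinearMap.ker g) →ₗ[R] X),
      p ∘ₗ i = LinearMap.id := by
  obtain ⟨i, hi⟩ := exists_map_to_quotSMulTop_ker hX hg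
  have h : f • (⊤ : Submodule R (LinearMap.ker g)) ≤ LinearMap.ker r := by
    rintro _ ⟨z, -, rfl⟩
    rw [LinearMap.mem_ker, DistribSMul.toLinearMap_apply, map_smul, hX]
  refine ⟨i, Submodule.liftQ _ r h, LinearMap.ext fun x ↦ ?_⟩
  obtain ⟨y, rfl⟩ := hg x
  rw [LinearMap.comp_apply, hi]
  exact hr y

end Koszul

lemma Fintype.linearCombination_algebraMap_comp {ι R S X : Type} [Fintype ι] [CommRing R]
    [CommRing S] [Algebra R S] [AddCommGroup X] [Module R X] [Module S X] [IsScalarTower R S X]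
    (x : ι → X) (y : ι → R) :
    Fintype.linearCombination S x (fun i ↦ algebraMap R S (y i)) =
      Fintype.linearCombination R x y := by
  simp [Fintype.linearCombination_apply]

open scoped Pointwise in
/-- The obstruction to lifting `X` along `B → Q`, with kernel generated by the regular element
`f`, lives in `Ext²_Q(X, X)`. -/
theorem exists_retraction_of_extVanishes_two {B Q X : Type} [CommRing B] [CommRing Q] [Algebra B Q]
    [AddCommGroup X] [Module Q X] [Module B X] [IsScalarTower B Q X] {f : B}
    (hsurj : Function.Surjective (algebraMap B Q))
    (hker : RingHom.ker (algebraMap B Q) = Ideal.span {f}) (hf : IsSMulRegular B f)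
    (hext : ExtVanishes Q 2 X X) {ι : Type} [Fintype ι] {x : ι → X}
    (hB : Function.Surjective (Fintype.linearCombination B x))
    (hQ : Function.Surjective (Fintype.linearCombination Q x)) (hX : ∀ x : X, f • x = 0) :
    ∃ r : LinearMap.ker (Fintype.linearCombination B x) →ₗ[B] X,
      ∀ y, r ⟨f • y, smul_mem_ker_of_smul_eq_zero hX _ y⟩ = Fintype.linearCombination B x y := by
  set gB := Fintype.linearCombination B x with hgB
  set gQ := Fintype.linearCombination Q x with hgQ
  have hcomp : ∀ y : ι → B, gQ (fun i ↦ algebraMap B Q (y i)) = gB y :=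
    Fintype.linearCombination_algebraMap_comp x
  have hfQ : algebraMap B Q f = 0 := by
    rw [← RingHom.mem_ker, hker]
    exact Ideal.mem_span_singleton_self f
  obtain ⟨a, ha⟩ := exists_map_to_quotSMulTop_ker hX hB
  let e : (B ⧸ Ideal.span {f}) ≃+* Q :=
    (Ideal.quotEquivOfEq hker.symm).trans (RingHom.quotientKerEquivOfSurjective hsurj)
  have he : ∀ b, e.symm (algebraMap B Q b) = Ideal.Quotient.mk _ b := fun b ↦
    (RingEquiv.symm_apply_eq e).2 rfl
  let W := QuotSMulTop f (LinearMap.ker gB)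
  let : Module Q W := Module.compHom W (e.symm : Q →+* B ⧸ Ideal.span {f})
  have : IsScalarTower B Q W := IsScalarTower.of_algebraMap_smul fun b w ↦ by
    change e.symm (algebraMap B Q b) • w = b • w
    rw [he]
    exact algebraMap_smul (B ⧸ Ideal.span {f}) b w
  have hmem : ∀ z : ι → B, z ∈ LinearMap.ker gB →
      (fun i ↦ algebraMap B Q (z i)) ∈ LinearMap.ker gQ := fun z hz ↦ by
    rw [LinearMap.mem_ker, hcomp]
    exact hz
  let b₀ : LinearMap.ker gB →ₗ[B] LinearMap.ker gQ :=
    { toFun z := ⟨fun i ↦ algebraMap B Q (z.1 i), hmem z.1 z.2⟩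
      map_add' z w := by ext; simp
      map_smul' c z := by ext; simp [Algebra.smul_def] }
  have hb₀ : f • (⊤ : Submodule B (LinearMap.ker gB)) ≤ LinearMap.ker b₀ := by
    rintro _ ⟨z, -, rfl⟩
    rw [LinearMap.mem_ker, DistribSMul.toLinearMap_apply, map_smul]
    ext i
    simp [Algebra.smul_def, hfQ]
  let b : W →ₗ[B] LinearMap.ker gQ := Submodule.liftQ _ b₀ hb₀
  have hb : ∀ z, b (Submodule.Quotient.mk z) = b₀ z := fun z ↦ rfl
  let aQ : X →ₗ[Q] W := a.extendScalarsOfSurjective hsurj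
  let bQ : W →ₗ[Q] LinearMap.ker gQ := b.extendScalarsOfSurjective hsurj
  have hainj : Function.Injective aQ := by
    refine (injective_iff_map_eq_zero _).2 fun t ht ↦ ?_
    obtain ⟨y, rfl⟩ := hB t
    obtain ⟨z, -, hz⟩ := (Submodule.Quotient.mk_eq_zero _).1 ((ha y).symm.trans ht)
    have : y = z.1 := funext fun i ↦ hf (congr_fun (congr_arg Subtype.val hz) i).symm
    rw [this]
    exact z.2
  have hexact : Function.Exact aQ bQ := fun w ↦ by
    obtain ⟨z, rfl⟩ := Submodule.Quotient.mk_surjective _ w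
    constructor
    · intro hz
      have hz' : ∀ i, ∃ c, c * f = z.1 i := fun i ↦ by
        rw [← Ideal.mem_span_singleton', ← hker, RingHom.mem_ker]
        exact congr_fun (congr_arg Subtype.val hz) i
      choose y hy using hz'
      refine ⟨gB y, (ha y).trans (congr_arg _ (Subtype.ext (funext fun i ↦ ?_)))⟩
      exact (mul_comm _ _).trans (hy i)
    · rintro ⟨t, ht⟩
      obtain ⟨y, rfl⟩ := hB t
      rw [← ht]
      refine (congr_arg b (ha y)).trans (Subtype.ext (funext fun i ↦ ?_))
      simp [b₀, hb, hfQ]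
  have hbsurj : Function.Surjective bQ := by
    rintro ⟨v, hv⟩
    choose y hy using fun i ↦ hsurj (v i)
    have hyv : (fun i ↦ algebraMap B Q (y i)) = v := funext hy
    refine ⟨Submodule.Quotient.mk ⟨y, ?_⟩, Subtype.ext hyv⟩
    rw [LinearMap.mem_ker, ← hcomp, hyv]
    exact hv
  obtain ⟨v, hv⟩ := ExtVanishes.exists_extend hainj hexact hbsurj
    ((ExtVanishes.left_succ_iff (LinearMap.ker gQ).injective_subtype
      (LinearMap.exact_subtype_ker_map gQ) hQ).2 hext) LinearMap.id
  refine ⟨v.restrictScalars B ∘ₗ Submodule.mkQ _, fun y ↦ ?_⟩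
  have := LinearMap.congr_fun hv (gB y)
  exact (congr_arg v (ha y).symm).trans this

lemma ProjDimLE.of_bijective {R Q : Type} [CommRing R] [CommRing Q] [IsNoetherianRing Q]
    [Algebra R Q]
    (hRQ : Function.Bijective (algebraMap R Q)) {n : ℕ} : ∀ {X : Type} [AddCommGroup X]
    [Module R X] [Module Q X] [IsScalarTower R Q X] [Module.Finite Q X],
    ProjDimLE R n X → ProjDimLE Q n X := by
  induction n with
  | zero =>
    intro X _ _ _ _ _ h
    have := projDimLE_zero_iff.1 h
    refine projDimLE_zero_iff.2
      (Module.Projective.of_lifting_property' fun {A B} _ _ _ _ g p hg ↦ ?_)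
    let := Module.compHom A (algebraMap R Q)
    let := Module.compHom B (algebraMap R Q)
    have : IsScalarTower R Q A := IsScalarTower.of_algebraMap_smul fun _ _ ↦ rfl
    have : IsScalarTower R Q B := IsScalarTower.of_algebraMap_smul fun _ _ ↦ rfl
    obtain ⟨u, hu⟩ := Module.projective_lifting_property (g.restrictScalars R)
      (p.restrictScalars R) hg
    exact ⟨u.extendScalarsOfSurjective hRQ.2, LinearMap.ext fun x ↦ LinearMap.congr_fun hu x⟩
  | succ n ih =>
    intro X _ _ _ _ _ h
    obtain ⟨m, g, hg⟩ := Module.Finite.exists_fin' Q X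
    have : Module.Projective R (Fin m → Q) := Module.Projective.of_equiv'
      (LinearEquiv.piCongrRight fun _ ↦ LinearEquiv.ofBijective (Algebra.linearMap R Q) hRQ)
    have hexact := LinearMap.exact_subtype_ker_map g
    refine (projDimLE_succ_iff (R := Q) (LinearMap.ker g).injective_subtype hexact hg).2 (ih ?_)
    exact (projDimLE_succ_iff (f := (LinearMap.ker g).subtype.restrictScalars R)
      (g := g.restrictScalars R) (LinearMap.ker g).injective_subtype
      hexact hg).1 h

lemma exists_projDimLE_quotient {S X : Type} [CommRing S] [IsNoetherianRing S] [IsLocalRing S]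
    [AddCommGroup X] [Module S X] {f : S} [Module (S ⧸ Ideal.span {f}) X]
    [IsScalarTower S (S ⧸ Ideal.span {f}) X] (hfm : f ∈ maximalIdeal S) (hf : IsSMulRegular S f)
    {ι : Type} [Fintype ι] {g : (ι → S) →ₗ[S] X} (hg : Function.Surjective g)
    (hX : ∀ x : X, f • x = 0) {r : LinearMap.ker g →ₗ[S] X}
    (hr : ∀ y, r ⟨f • y, smul_mem_ker_of_smul_eq_zero hX g y⟩ = g y)
    (hpd : ∃ k, ProjDimLE S k X) : ∃ k, ProjDimLE (S ⧸ Ideal.span {f}) k X := by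
  obtain ⟨k, hk⟩ := hpd
  have hinj := (LinearMap.ker g).injective_subtype
  obtain ⟨i, p, hpi⟩ := retract_quotSMulTop_ker hX hg hr
  have hxF : IsSMulRegular (ι → S) f := IsSMulRegular.pi fun _ ↦ hf
  have h := (projDimLE_succ_iff hinj (LinearMap.exact_subtype_ker_map g) hg).1 (hk.mono k.le_succ)
  exact ⟨k, ((projDimLE_quotSMulTop_iff hfm hf (hxF.of_injective _ hinj)).2 h).retract
    (i.extendScalarsOfSurjective Ideal.Quotient.mk_surjective)
    (p.extendScalarsOfSurjective Ideal.Quotient.mk_surjective)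
    (LinearMap.ext fun x ↦ LinearMap.congr_fun hpi x)⟩

theorem exists_projDimLE_of_isWeaklyRegular {Q X : Type} [CommRing Q] [AddCommGroup X] [Module Q X]
    [Module.Finite Q X] (hext : ExtVanishes Q 2 X X) (n : ℕ) : ∀ {S : Type} [CommRing S]
    [IsNoetherianRing S] [IsLocalRing S] [Algebra S Q] [Module S X] [IsScalarTower S Q X]
    {rs : List S}, rs.length = n → Function.Surjective (algebraMap S Q) →
    RingHom.ker (algebraMap S Q) = Ideal.ofList rs →
    RingTheory.Sequence.IsWeaklyRegular S rs → (∀ x ∈ rs, x ∈ maximalIdeal S) →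
    (∃ k, ProjDimLE S k X) → ∃ k, ProjDimLE Q k X := by
  induction n with
  | zero =>
    intro S _ _ _ _ _ _ rs hlen hsurj hker _ _ ⟨k, hk⟩
    rw [List.eq_nil_of_length_eq_zero hlen, Ideal.ofList_nil] at hker
    have := isNoetherianRing_of_surjective _ _ _ hsurj
    exact ⟨k, hk.of_bijective ⟨(RingHom.injective_iff_ker_eq_bot _).2 hker, hsurj⟩⟩
  | succ n ih =>
    intro S _ _ _ _ _ _ rs hlen hsurj hker hreg hrs hpd
    obtain _ | ⟨f, rs⟩ := rs
    · simp at hlen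
    have hfm : f ∈ maximalIdeal S := hrs f (by simp)
    obtain ⟨hf, hreg'⟩ := (RingTheory.Sequence.isWeaklyRegular_cons_iff S f rs).1 hreg
    have hfQ : algebraMap S Q f = 0 := by
      rw [← RingHom.mem_ker, hker]
      exact Ideal.subset_span (by simp)
    have hX : ∀ x : X, f • x = 0 := fun x ↦ by
      rw [← algebraMap_smul Q f x, hfQ, zero_smul]
    obtain ⟨m, x, hx⟩ := Module.Finite.exists_fin (R := Q) (M := X)
    have hQ : Function.Surjective (Fintype.linearCombination Q x) := by
      rw [← LinearMap.range_eq_top, Fintype.range_linearCombination, hx]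
    have hlc : ∀ {R : Type} [CommRing R] [Algebra R Q] [Module R X] [IsScalarTower R Q X],
        Function.Surjective (algebraMap R Q) →
        Function.Surjective (Fintype.linearCombination R x) := fun hR t ↦ by
      obtain ⟨v, rfl⟩ := hQ t
      choose y hy using fun i ↦ hR (v i)
      exact ⟨y, by rw [← Fintype.linearCombination_algebraMap_comp (S := Q), funext hy]⟩
    let lift (I : Ideal S) (hI : I ≤ Ideal.ofList (f :: rs)) : S ⧸ I →+* Q :=
      Ideal.Quotient.lift I (algebraMap S Q) fun a ha ↦ by
        rw [← RingHom.mem_ker, hker]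
        exact hI ha
    obtain ⟨r, hr⟩ : ∃ r : LinearMap.ker (Fintype.linearCombination S x) →ₗ[S] X,
        ∀ y, r ⟨f • y, smul_mem_ker_of_smul_eq_zero hX _ y⟩ =
          Fintype.linearCombination S x y := by
      let B := S ⧸ Ideal.ofList rs
      let : Algebra B Q := (lift (Ideal.ofList rs) (by simp)).toAlgebra
      let : Module B X := Module.compHom X (algebraMap B Q)
      have : IsScalarTower B Q X := IsScalarTower.of_algebraMap_smul fun _ _ ↦ rfl
      have : IsScalarTower S B Q := IsScalarTower.of_algebraMap_eq fun _ ↦ rfl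
      have : IsScalarTower S B X := IsScalarTower.of_algebraMap_smul fun b t ↦
        algebraMap_smul Q b t
      have hBQ : Function.Surjective (algebraMap B Q) := fun q ↦ by
        obtain ⟨s, rfl⟩ := hsurj q
        exact ⟨algebraMap S B s, rfl⟩
      have hkerB : RingHom.ker (algebraMap B Q) = Ideal.span {algebraMap S B f} := by
        refine (Ideal.ker_quotient_lift _ _).trans ?_
        rw [hker, Ideal.ofList_cons, Ideal.map_sup, Ideal.map_quotient_self, sup_bot_eq,
          Ideal.map_span, Set.image_singleton]
        rfl
      have hfB : IsSMulRegular B (algebraMap S B f) := by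
        have h := IsLocalRing.isWeaklyRegular_of_perm_of_subset_maximalIdeal hreg
          (List.perm_append_singleton f rs).symm hrs
        have h' := (RingTheory.Sequence.isWeaklyRegular_singleton_iff _ f).1
          ((RingTheory.Sequence.isWeaklyRegular_append_iff S rs [f]).1 h).2
        have e : (S ⧸ (Ideal.ofList rs • ⊤ : Submodule S S)) ≃ₗ[S] B :=
          Submodule.quotEquivOfEq _ _ (by rw [smul_eq_mul, Ideal.mul_top])
        have hB : IsSMulRegular B f := (e.isSMulRegular_congr f).1 h'
        exact fun a b hab ↦ hB (by simpa [Algebra.smul_def] using hab)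
      have hXB : ∀ t : X, algebraMap S B f • t = 0 := fun t ↦ by rw [algebraMap_smul, hX]
      obtain ⟨r, hr⟩ := exists_retraction_of_extVanishes_two hBQ hkerB hfB hext (hlc hBQ) hQ hXB
      let c : LinearMap.ker (Fintype.linearCombination S x) →ₗ[S]
          LinearMap.ker (Fintype.linearCombination B x) :=
        { toFun z := ⟨fun i ↦ algebraMap S B (z.1 i), by
            rw [LinearMap.mem_ker, Fintype.linearCombination_algebraMap_comp]
            exact z.2⟩
          map_add' z w := by ext; simp
          map_smul' s z := by ext; simp [Algebra.smul_def] }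
      refine ⟨r.restrictScalars S ∘ₗ c, fun y ↦ ?_⟩
      rw [← Fintype.linearCombination_algebraMap_comp (S := B), ← hr]
      refine congr_arg r (Subtype.ext (funext fun i ↦ ?_))
      simp [c]
    let S' := S ⧸ Ideal.span {f}
    have hle : Ideal.span {f} ≤ maximalIdeal S := by rwa [Ideal.span_singleton_le_iff_mem]
    have : Nontrivial S' := Ideal.Quotient.nontrivial_iff.2
      (hle.trans_lt (Ideal.IsMaximal.ne_top inferInstance).lt_top).ne
    have : IsLocalRing S' := IsLocalRing.of_surjective' _ Ideal.Quotient.mk_surjective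
    let : Algebra S' Q := (lift (Ideal.span {f}) (by simp)).toAlgebra
    let : Module S' X := Module.compHom X (algebraMap S' Q)
    have : IsScalarTower S' Q X := IsScalarTower.of_algebraMap_smul fun _ _ ↦ rfl
    have : IsScalarTower S S' X := IsScalarTower.of_algebraMap_smul fun b t ↦
      algebraMap_smul Q b t
    refine ih (S := S') (rs := rs.map (algebraMap S S')) (by simpa using hlen) (fun q ↦ ?_) ?_ ?_
      ?_ (exists_projDimLE_quotient hfm hf (hlc hsurj) hX hr hpd)
    · obtain ⟨s, rfl⟩ := hsurj q
      exact ⟨algebraMap S S' s, rfl⟩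
    · refine (Ideal.ker_quotient_lift _ _).trans ?_
      rw [hker, Ideal.map_ofList, List.map_cons, Ideal.ofList_cons,
        Ideal.Quotient.mk_singleton_self, Ideal.span_singleton_zero, bot_sup_eq]
      rfl
    · rw [RingTheory.Sequence.isWeaklyRegular_map_algebraMap_iff]
      have e : QuotSMulTop f S ≃ₗ[S] S' :=
        Submodule.quotEquivOfEq _ _ (by simp [← Submodule.ideal_span_singleton_smul])
      exact (e.isWeaklyRegular_congr rs).1 hreg'
    · intro y hy
      obtain ⟨z, hz, rfl⟩ := List.mem_map.1 hy
      have := IsLocalHom.of_surjective (algebraMap S S') Ideal.Quotient.mk_surjective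
      exact map_nonunit _ _ (hrs z (by simp [hz]))

end ChangeOfRings

section AuslanderBuchsbaum

variable {A : Type} [CommRing A] [IsLocalRing A]

lemma ext_comp_mk₀_toSpanSingleton_eq_zero {t m : ℕ} {v : Fin m → A}
    (hv : ∀ i, v i ∈ maximalIdeal A)
    (y : Abelian.Ext.{0} (ModuleCat.of A (A ⧸ maximalIdeal A)) (ModuleCat.of A A) t) :
    y.comp (Abelian.Ext.mk₀ (ModuleCat.ofHom (LinearMap.toSpanSingleton A (Fin m → A) v)))
      (add_zero t) = 0 := by
  have hy (a : A) (ha : a ∈ maximalIdeal A) : a • y = 0 := by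
    have h0 : a • 𝟙 (ModuleCat.of A (A ⧸ maximalIdeal A)) = 0 := by
      refine ModuleCat.hom_ext (LinearMap.ext fun x ↦ ?_)
      obtain ⟨x, rfl⟩ := Ideal.Quotient.mk_surjective x
      exact Ideal.Quotient.eq_zero_iff_mem.2 (Ideal.mul_mem_right x _ ha)
    rw [← y.mk₀_id_comp, ← Abelian.Ext.smul_comp, ← Abelian.Ext.mk₀_smul, h0,
      Abelian.Ext.mk₀_zero, Abelian.Ext.zero_comp]
  have hg : ModuleCat.ofHom (LinearMap.toSpanSingleton A (Fin m → A) v) =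
      ∑ i, v i • ModuleCat.ofHom (LinearMap.single A (fun _ ↦ A) i) := by
    ext
    simp [ModuleCat.hom_sum, Pi.single_apply, Finset.sum_apply]
  rw [hg, Abelian.Ext.mk₀_sum, Abelian.Ext.comp_sum]
  refine Finset.sum_eq_zero fun i _ ↦ ?_
  rw [Abelian.Ext.mk₀_smul, Abelian.Ext.comp_smul, ← Abelian.Ext.smul_comp, hy _ (hv i),
    Abelian.Ext.zero_comp]

variable {M K : Type} [AddCommGroup M] [Module A M] [AddCommGroup K] [Module A K]

/-- The key step of the Auslander–Buchsbaum formula. -/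
lemma apply_mem_maximalIdeal_of_extVanishes {t m : ℕ} {f : K →ₗ[A] Fin m → A}
    {g : (Fin m → A) →ₗ[A] M} (hf : Function.Injective f) (hfg : Function.Exact f g)
    (hg : Function.Surjective g) (hM : ∀ i < t, ExtVanishes A i (A ⧸ maximalIdeal A) M)
    (hA : ¬ ExtVanishes A t (A ⧸ maximalIdeal A) A) {x : K} (hx : ∀ i, f x i ∈ maximalIdeal A)
    (ρ : K →ₗ[A] A) : ρ x ∈ maximalIdeal A := by
  by_contra hρ
  obtain ⟨u, hu⟩ : IsUnit (ρ x) := by simpa using hρ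
  refine hA (extVanishes_iff.2 fun y ↦ ?_)
  have h0 : (y.comp (Abelian.Ext.mk₀ (ModuleCat.ofHom (LinearMap.toSpanSingleton A K x)))
      (add_zero t)) = 0 := by
    have h1 : (y.comp (Abelian.Ext.mk₀ (ModuleCat.ofHom (LinearMap.toSpanSingleton A K x)))
        (add_zero t)).comp (Abelian.Ext.mk₀ (ModuleCat.ofHom f)) (add_zero t) = 0 := by
      rw [Abelian.Ext.comp_assoc_of_third_deg_zero, Abelian.Ext.mk₀_comp_mk₀,
        ← ModuleCat.ofHom_comp, LinearMap.comp_toSpanSingleton]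
      exact ext_comp_mk₀_toSpanSingleton_eq_zero hx y
    cases t with
    | zero =>
      generalize y.comp (Abelian.Ext.mk₀ (ModuleCat.ofHom (LinearMap.toSpanSingleton A K x)))
        (add_zero 0) = z at h1
      obtain ⟨z, rfl⟩ := Abelian.Ext.homEquiv₀.symm.surjective z
      have : Mono (ModuleCat.ofHom f) := (ModuleCat.mono_iff_injective _).2 hf
      simp only [Abelian.Ext.homEquiv₀_symm_apply, Abelian.Ext.mk₀_comp_mk₀,
        Abelian.Ext.mk₀_eq_zero_iff] at h1 ⊢
      exact Limits.zero_of_comp_mono _ h1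
    | succ t =>
      obtain ⟨z, hz⟩ := Abelian.Ext.covariant_sequence_exact₁ _
        (shortExact_of_linearMap hf hfg hg) _ h1 rfl
      rw [← hz, extVanishes_iff.1 (hM t t.lt_succ_self) z, Abelian.Ext.zero_comp]
  have h2 := congrArg (fun z ↦ z.comp (Abelian.Ext.mk₀ (ModuleCat.ofHom ((↑u⁻¹ : A) • ρ)))
    (add_zero t)) h0
  have h3 : ((↑u⁻¹ : A) • ρ) ∘ₗ LinearMap.toSpanSingleton A K x = LinearMap.id := by
    ext
    simp [← hu]
  rwa [Abelian.Ext.comp_assoc_of_third_deg_zero, Abelian.Ext.mk₀_comp_mk₀,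
    ← ModuleCat.ofHom_comp, h3, Abelian.Ext.zero_comp, ModuleCat.ofHom_id,
    Abelian.Ext.comp_mk₀_id] at h2

lemma exists_retraction_of_coord_mem_maximalIdeal [Module.Finite A K] [Module.Free A K] {m : ℕ}
    (f : K →ₗ[A] Fin m → A) (H : ∀ (x : K) (ρ : K →ₗ[A] A), (∀ i, f x i ∈ maximalIdeal A) →
      ρ x ∈ maximalIdeal A) : ∃ r, r ∘ₗ f = LinearMap.id := by
  rw [IsLocalRing.split_injective_iff_lTensor_residueField_injective, injective_iff_map_eq_zero]
  intro z hz
  obtain ⟨x, rfl⟩ := TensorProduct.mk_surjective A K (ResidueField A) residue_surjective z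
  have hx (i) : f x i ∈ maximalIdeal A := by
    have := congrArg (TensorProduct.rid A (ResidueField A) ∘
      LinearMap.lTensor (ResidueField A) (LinearMap.proj i)) hz
    simpa [Algebra.smul_def] using this
  let b := Module.Free.chooseBasis A K
  rw [TensorProduct.mk_apply, ← b.sum_repr x, TensorProduct.tmul_sum]
  refine Finset.sum_eq_zero fun i _ ↦ ?_
  have : b.repr x i ∈ maximalIdeal A := H x (b.coord i) hx
  rw [← TensorProduct.smul_tmul, Algebra.smul_def, mul_one, ResidueField.algebraMap_eq,
    (residue_eq_zero_iff _).2 this, TensorProduct.zero_tmul]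

lemma extVanishes_residue_of_injective {t m : ℕ} {f : K →ₗ[A] Fin m → A}
    {g : (Fin m → A) →ₗ[A] M} (hf : Function.Injective f) (hfg : Function.Exact f g)
    (hg : Function.Surjective g) (hA : ∀ i < t, ExtVanishes A i (A ⧸ maximalIdeal A) A)
    (hM : ∀ i, i + 1 < t → ExtVanishes A i (A ⧸ maximalIdeal A) M) :
    ∀ i < t, ExtVanishes A i (A ⧸ maximalIdeal A) K
  | 0, hi => extVanishes_zero_iff.2 fun h ↦ by
      have := extVanishes_zero_iff.1 ((hA 0 hi).pi_right m) (f ∘ₗ h)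
      exact LinearMap.ext fun x ↦ hf (by simpa using LinearMap.congr_fun this x)
  | i + 1, hi => (hM i hi).cov_left hf hfg hg ((hA (i + 1) hi).pi_right m)

theorem ProjDimLE.projective_of_extVanishes_residue [IsNoetherianRing A] {t : ℕ}
    (hA : ∀ i < t, ExtVanishes A i (A ⧸ maximalIdeal A) A)
    (hA' : ¬ ExtVanishes A t (A ⧸ maximalIdeal A) A) {n : ℕ} : ∀ {M : Type} [AddCommGroup M]
    [Module A M] [Module.Finite A M], ProjDimLE A n M →
    (∀ i < t, ExtVanishes A i (A ⧸ maximalIdeal A) M) → Module.Projective A M := by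
  induction n with
  | zero => exact fun h _ ↦ projDimLE_zero_iff.1 h
  | succ n ih =>
    intro M _ _ _ h hM
    obtain ⟨m, g, hg⟩ := Module.Finite.exists_fin' A M
    have hf := (LinearMap.ker g).injective_subtype
    have hfg := LinearMap.exact_subtype_ker_map g
    have hK := ih ((projDimLE_succ_iff hf hfg hg).1 h)
      (extVanishes_residue_of_injective hf hfg hg hA fun i hi ↦ hM i (by lia))
    have : Module.Free A (LinearMap.ker g) := Module.free_of_flat_of_isLocalRing
    obtain ⟨r, hr⟩ := exists_retraction_of_coord_mem_maximalIdeal (LinearMap.ker g).subtype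
      fun x ρ hx ↦ apply_mem_maximalIdeal_of_extVanishes hf hfg hg hM hA' hx ρ
    obtain ⟨s, hs⟩ := ((hfg.split_tfae hf hg).out 1 0).mp (Exists.intro r hr)
    exact .of_split s g hs

end AuslanderBuchsbaum

section CompleteIntersection

lemma ProjDimLE.of_baseChange {A C : Type} [CommRing A] [IsNoetherianRing A] [IsLocalRing A]
    [CommRing C] [Algebra A C] [Module.FaithfullyFlat A C] {n : ℕ} : ∀ {M : Type} [AddCommGroup M]
    [Module A M] [Module.Finite A M], ProjDimLE C n (C ⊗[A] M) → ProjDimLE A n M := by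
  induction n with
  | zero =>
    intro M _ _ _ h
    rw [projDimLE_zero_iff] at h ⊢
    have := Module.Flat.of_flat_tensorProduct A M C
    have : Module.Free A M := Module.free_of_flat_of_isLocalRing
    infer_instance
  | succ n ih =>
    intro M _ _ _ h
    obtain ⟨m, g, hg⟩ := Module.Finite.exists_fin' A M
    have hf := (LinearMap.ker g).injective_subtype
    have hfg := LinearMap.exact_subtype_ker_map g
    exact (projDimLE_succ_iff hf hfg hg).2 (ih ((projDimLE_succ_iff
      (f := (LinearMap.ker g).subtype.baseChange C) (g := g.baseChange C)
      (Module.Flat.lTensor_preserves_injective_linearMap _ hf) (lTensor_exact C hfg hg)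
      (LinearMap.lTensor_surjective C hg)).1 h))

lemma exists_projDimLE_of_surjective {S C X : Type} [CommRing S] [IsNoetherianRing S]
    [IsLocalRing S] [CommRing C] [Algebra S C] [AddCommGroup X] [Module C X] [Module.Finite C X]
    {rs : List S} (hS : IsRegularLocal S) (hsurj : Function.Surjective (algebraMap S C))
    (hker : RingHom.ker (algebraMap S C) = Ideal.ofList rs)
    (hrs : RingTheory.Sequence.IsWeaklyRegular S rs) (hmem : ∀ x ∈ rs, x ∈ maximalIdeal S)
    (hX : ExtVanishes C 2 X X) : ∃ k, ProjDimLE C k X := by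
  obtain ⟨s, hs, hcard⟩ := hS
  let : Module S X := .compHom _ (algebraMap S C)
  have : IsScalarTower S C X := .of_algebraMap_smul fun _ _ ↦ rfl
  have : Module.Finite S C := .of_surjective (Algebra.linearMap S C) hsurj
  have : Module.Finite S X := .trans C _
  exact exists_projDimLE_of_isWeaklyRegular hX rs.length rfl hsurj hker hrs hmem
    ((isDomain_and_exists_projDimLE s.card S s hs le_rfl hcard.le).2 _)

lemma exists_projDimLE_of_isCompleteIntersectionLocal {A : Type} [CommRing A] [IsNoetherianRing A]
    [IsLocalRing A] (hA : IsCompleteIntersectionLocal A) {M : Type} [AddCommGroup M] [Module A M]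
    [Module.Finite A M] (hM : ExtVanishes A 2 M M) : ∃ k, ProjDimLE A k M := by
  obtain ⟨S, _, _, _, rs, hS, hrs, hmem, ⟨e⟩⟩ := hA
  let C := AdicCompletion (maximalIdeal A) A
  have : Module.Flat A C := AdicCompletion.flat_of_isNoetherian _
  have : Module.FaithfullyFlat A C := .of_flat_of_isLocalHom
  let φ : S →+* C := e.symm.toRingHom.comp (Ideal.Quotient.mk _)
  let : Algebra S C := φ.toAlgebra
  have hsurj : Function.Surjective (algebraMap S C) :=
    e.symm.surjective.comp Ideal.Quotient.mk_surjective
  have hker : RingHom.ker (algebraMap S C) = Ideal.ofList rs := by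
    ext x
    exact (map_eq_zero_iff e.symm e.symm.injective).trans Ideal.Quotient.eq_zero_iff_mem
  obtain ⟨k, hk⟩ := exists_projDimLE_of_surjective hS hsurj hker hrs.toIsWeaklyRegular hmem
    (hM.baseChange C)
  exact ⟨k, hk.of_baseChange⟩

theorem projective_of_isCompleteIntersectionLocal {A : Type} [CommRing A] [IsNoetherianRing A]
    [IsLocalRing A] (hA : IsCompleteIntersectionLocal A) {t : ℕ} (ht : t ≤ 1)
    (hk : ∀ i < t, ExtVanishes A i (A ⧸ maximalIdeal A) A)
    (hk' : ¬ ExtVanishes A t (A ⧸ maximalIdeal A) A) {M : Type} [AddCommGroup M] [Module A M]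
    [Module.Finite A M] (hM : ExtVanishes A 1 M A) (hMM : ExtVanishes A 2 M M) :
    Module.Projective A M := by
  obtain ⟨n, hn⟩ := exists_projDimLE_of_isCompleteIntersectionLocal hA hMM
  obtain ⟨m, g, hg⟩ := Module.Finite.exists_fin' A M
  have hf := (LinearMap.ker g).injective_subtype
  have hfg := LinearMap.exact_subtype_ker_map g
  have := ((projDimLE_succ_iff hf hfg hg).1 (hn.mono n.le_succ)).projective_of_extVanishes_residue
    hk hk' (extVanishes_residue_of_injective hf hfg hg hk fun i hi ↦ by lia)
  exact projective_of_projective_syzygy hf hfg hg hM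

end CompleteIntersection

section Localization

variable {R M : Type} [CommRing R] [AddCommGroup M] [Module R M] [Module.Finite R M]

lemma algebraMap_mem_freeFactorIdeal (C : Type) [CommRing C] [Algebra R C] {s : R}
    (hs : s ∈ freeFactorIdeal R M) : algebraMap R C s ∈ freeFactorIdeal C (C ⊗[R] M) := by
  obtain ⟨n, π, hπ⟩ := Module.Finite.exists_fin' R M
  obtain ⟨h, hh⟩ := exists_lift_of_mem_range_dualTensorHom hπ hs
  have key : algebraMap R C s • LinearMap.id = π.baseChange C ∘ₗ h.baseChange C := by
    rw [← LinearMap.baseChange_comp, hh]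
    ext
    simp
  rw [mem_freeFactorIdeal, key]
  exact comp_mem_range_dualTensorHom_right _ (mem_range_dualTensorHom_of_free _)

lemma exists_mem_freeFactorIdeal_of_projective [IsNoetherianRing R] (S : Submonoid R)
    (C : Type) [CommRing C] [Algebra R C] [IsLocalization S C] [Module.Projective C (C ⊗[R] M)] :
    ∃ s ∈ S, s ∈ freeFactorIdeal R M := by
  have : Module.FinitePresentation R M := Module.finitePresentation_of_finite R M
  obtain ⟨n, π, hπ⟩ := Module.Finite.exists_fin' R M
  obtain ⟨σ, hσ⟩ := Module.projective_lifting_property (π.baseChange C) LinearMap.id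
    (LinearMap.lTensor_surjective C hπ)
  obtain ⟨h, s, hs⟩ := Module.FinitePresentation.exists_lift_of_isLocalizedModule S
    (TensorProduct.mk R C (Fin n → R) 1) (σ.restrictScalars R ∘ₗ TensorProduct.mk R C M 1)
  obtain ⟨s', hs'⟩ := Module.Finite.exists_smul_of_comp_eq_of_isLocalizedModule S
    (TensorProduct.mk R C M 1) (π ∘ₗ h) (s • LinearMap.id) <| by
      ext x
      have h1 := congrArg (π.baseChange C) (LinearMap.congr_fun hs x)
      have h2 := LinearMap.congr_fun hσ (1 ⊗ₜ x)
      simp only [LinearMap.comp_apply, LinearMap.smul_apply, Submonoid.smul_def,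
        LinearMap.restrictScalars_apply, TensorProduct.mk_apply, LinearMap.id_apply,
        LinearMap.baseChange_tmul, LinearMap.map_smul_of_tower] at h1 h2 ⊢
      rw [h1, h2]
  refine ⟨s' * s, (s' * s).2, ?_⟩
  rw [mem_freeFactorIdeal, mul_smul]
  have : (s' : R) • (s : R) • LinearMap.id = π ∘ₗ ((s' : R) • h) := by
    rw [LinearMap.comp_smul]
    exact hs'.symm
  rw [this]
  exact comp_mem_range_dualTensorHom_right _ (mem_range_dualTensorHom_of_free _)

lemma maximalIdeal_le_radical_freeFactorIdeal {p : Ideal R} [p.IsPrime]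
    (hp : p ∈ (freeFactorIdeal R M).minimalPrimes) :
    maximalIdeal (Localization.AtPrime p) ≤
      (freeFactorIdeal (Localization.AtPrime p) (Localization.AtPrime p ⊗[R] M)).radical := by
  rw [← IsLocalization.AtPrime.map_eq_maximalIdeal p,
    ← IsLocalization.AtPrime.radical_map_of_mem_minimalPrimes _ p _ hp]
  exact Ideal.radical_mono (Ideal.map_le_iff_le_comap.2 fun s hs ↦
    algebraMap_mem_freeFactorIdeal _ hs)

end Localization

lemma IsCMLocal.exists_extVanishes {A : Type} [CommRing A] [IsNoetherianRing A] [IsLocalRing A]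
    (hA : IsCMLocal A) : ∃ t : ℕ, ringKrullDim A = t ∧
      (∀ i < t, ExtVanishes A i (A ⧸ maximalIdeal A) A) ∧
      ¬ ExtVanishes A t (A ⧸ maximalIdeal A) A := by
  rw [IsCMLocal, ← IsLocalRing.maximalIdeal_height_eq_ringKrullDim, WithBot.coe_inj] at hA
  have hfin : moduleDepth A A ≠ ⊤ := by
    rw [hA]
    exact Ideal.height_ne_top Ideal.IsPrime.ne_top'
  have hmem := csInf_mem (s := {n : ℕ∞ | ∃ k : ℕ, n = k ∧
    Nontrivial (extGroup A k (A ⧸ maximalIdeal A) A)}) <| by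
      rw [Set.nonempty_iff_ne_empty]
      intro h
      exact hfin (by rw [moduleDepth, h, sInf_empty])
  obtain ⟨t, ht, hnt⟩ := hmem
  change moduleDepth A A = t at ht
  refine ⟨t, ?_, fun i hi ↦ ?_, fun h ↦ ?_⟩
  · rw [← IsLocalRing.maximalIdeal_height_eq_ringKrullDim, ← hA, ht]
    rfl
  · rw [← subsingleton_extGroup_iff, ← not_nontrivial_iff_subsingleton]
    intro hn
    have : moduleDepth A A ≤ i := sInf_le ⟨i, rfl, hn⟩
    rw [ht] at this
    exact absurd (Nat.cast_le.1 this) (not_le.2 hi)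
  · exact not_subsingleton_iff_nontrivial.2 hnt (subsingleton_extGroup_iff.2 h)

/-- Over a `d`-dimensional Cohen–Macaulay ring which is locally a complete intersection in
codimension one, vanishing of `Ext^i(M, R)` for `1 ≤ i ≤ 2d+1` and `Ext^j(M, M)` for
`1 ≤ j ≤ max 2 (d−1)` implies `M` projective. -/
theorem projective_of_ext_vanishing_lci_codim_one (R : Type) [CommRing R] [IsNoetherianRing R]
    (d : ℕ) (hd : ringKrullDim R = d)
    (hCM : ∀ p : PrimeSpectrum R, IsCMLocal (Localization.AtPrime p.asIdeal))
    (hCI : ∀ p : PrimeSpectrum R, ringKrullDim (Localization.AtPrime p.asIdeal) ≤ (1 : WithBot ℕ∞) →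
      IsCompleteIntersectionLocal (Localization.AtPrime p.asIdeal))
    (M : Type) [AddCommGroup M] [Module R M] [Module.Finite R M]
    (h1 : ∀ i : ℕ, 1 ≤ i → i ≤ 2 * d + 1 → Subsingleton (extGroup R i M R))
    (h2 : ∀ j : ℕ, 1 ≤ j → j ≤ max 2 (d - 1) → Subsingleton (extGroup R j M M)) :
    Module.Projective R M := by
  by_contra hM
  have hI : freeFactorIdeal R M ≠ ⊤ := fun h ↦ hM (projective_of_freeFactorIdeal_eq_top h)
  obtain ⟨p, hp⟩ := Ideal.nonempty_minimalPrimes hI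
  have : p.IsPrime := hp.1.1
  let A := Localization.AtPrime p
  have : IsNoetherianRing A := IsLocalization.isNoetherianRing p.primeCompl A inferInstance
  have : Module.Flat R A := IsLocalization.flat A p.primeCompl
  obtain ⟨t, ht, hk, hk'⟩ := (hCM ⟨p, ‹_›⟩).exists_extVanishes
  have htd : t ≤ d := by
    have := Ideal.height_le_ringKrullDim_of_isPrime (I := p)
    rw [← IsLocalization.AtPrime.ringKrullDim_eq_height p A, hd] at this
    exact_mod_cast ht ▸ this
  have hNA (i : ℕ) (hi : i < 2 * d + 1) : ExtVanishes A (i + 1) (A ⊗[R] M) A :=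
    ((subsingleton_extGroup_iff.1 (h1 (i + 1) (by lia) (by lia))).baseChange A).congr
      (.refl A _) (TensorProduct.AlgebraTensorModule.rid R A A)
  have hNN (j : ℕ) (hj : j + 1 ≤ max 2 (d - 1)) :
      ExtVanishes A (j + 1) (A ⊗[R] M) (A ⊗[R] M) :=
    (subsingleton_extGroup_iff.1 (h2 (j + 1) (by lia) hj)).baseChange A
  have hproj : Module.Projective A (A ⊗[R] M) := by
    rcases le_or_gt t 1 with ht1 | ht1
    · exact projective_of_isCompleteIntersectionLocal (hCI ⟨p, ‹_›⟩ (ht.trans_le (mod_cast ht1)))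
        ht1 hk hk' (hNA 0 (by lia)) (hNN 1 (by lia))
    · obtain ⟨t, rfl⟩ := Nat.exists_eq_add_of_lt ht1
      exact projective_of_extVanishes_of_two_le_depth ht1 hk hk' (fun i hi ↦ hNA i (by lia))
        (by simpa [add_assoc, add_comm] using hNN t (by lia))
        (maximalIdeal_le_radical_freeFactorIdeal hp)
  obtain ⟨s, hs, hsI⟩ := exists_mem_freeFactorIdeal_of_projective (M := M) p.primeCompl A
  exact hs (hp.1.2 hsI)
end
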